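/- arXiv:1109.5020 — 2 statements merged into one kernel-verified Lean document; each statement's English description precedes it below -/
import Mathlib

section
/- Let N ≥ 2, k ≥ 0 and N/2 < p ≤ ∞. Then the infimum γ_{p,k} is attained: there exists a_0 ∈ Γ_k ∩ L^p(B_1) such that ‖a_0 − μ_k‖_{L^p(B_1)} = γ_{p,k}. -/
open MeasureTheory Set Filter

noncomputable section

/-- The measure of the (N-1)-dimensional unit sphere in `ℝ^N`. -/
def omegaN (N : ℕ) : ℝ :=
  N * (volume (Metric.ball (0 : EuclideanSpace ℝ (Fin N)) 1)).toReal

/-- `u` is a radial Neumann solution of `Δu + a u = 0` on the unit ball of `ℝ^N`,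
with explicit derivative function `u'` : `u` is continuous on `[0,1]`, differentiable on
`(0,1]`, satisfies the integrated radial equation
`r^(N-1) u'(r) = -∫_0^r s^(N-1) a(s) u(s) ds` on `(0,1]`, and `u'(1) = 0`. -/
def IsRadialNeumannSolutionDeriv (N : ℕ) (a u u' : ℝ → ℝ) : Prop :=
  ContinuousOn u (Icc 0 1) ∧
  (∀ r ∈ Ioc (0:ℝ) 1, HasDerivAt u (u' r) r) ∧
  (∀ r ∈ Ioc (0:ℝ) 1,
    r ^ (N - 1) * u' r = - ∫ s in (0:ℝ)..r, s ^ (N - 1) * a s * u s) ∧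
  u' 1 = 0

/-- `u` is a radial Neumann solution of `Δu + a u = 0` on the unit ball of `ℝ^N`. -/
def IsRadialNeumannSolution (N : ℕ) (a u : ℝ → ℝ) : Prop :=
  ∃ u' : ℝ → ℝ, IsRadialNeumannSolutionDeriv N a u u'

/-- `u` is not identically zero on `[0,1]`. -/
def NontrivialSol (u : ℝ → ℝ) : Prop := ∃ r ∈ Icc (0:ℝ) 1, u r ≠ 0

/-- `μ ≺ a` : `a(r) ≥ μ` for a.e. `r ∈ (0,1)` and `a(r) > μ` on a set of positive measure. -/
def Prec (μ : ℝ) (a : ℝ → ℝ) : Prop :=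
  (∀ᵐ r ∂(volume.restrict (Ioo (0:ℝ) 1)), μ ≤ a r) ∧
  0 < volume {r ∈ Ioo (0:ℝ) 1 | μ < a r}

/-- A radial function `a` belongs to `L^p(B_1)` (finite `p`). -/
def RadialMemLp (N : ℕ) (p : ℝ) (a : ℝ → ℝ) : Prop :=
  IntegrableOn (fun r => r ^ (N - 1) * |a r| ^ p) (Ioo (0:ℝ) 1)

/-- A radial function `a` belongs to `L^∞(B_1)`. -/
def RadialMemLinfty (a : ℝ → ℝ) : Prop :=
  ∃ C : ℝ, ∀ᵐ r ∂(volume.restrict (Ioo (0:ℝ) 1)), |a r| ≤ C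

/-- The `L^p(B_1)` norm of a radial function (finite `p`):
`(ω_N ∫_0^1 r^(N-1) |a(r)|^p dr)^(1/p)`. -/
def radialLpNorm (N : ℕ) (p : ℝ) (a : ℝ → ℝ) : ℝ :=
  (omegaN N * ∫ r in (0:ℝ)..1, r ^ (N - 1) * |a r| ^ p) ^ (1 / p)

/-- The `L^∞(B_1)` norm of a radial function: essential supremum of `|a|` on `(0,1)`. -/
def radialLinftyNorm (a : ℝ → ℝ) : ℝ :=
  essSup (fun r => |a r|) (volume.restrict (Ioo (0:ℝ) 1))

/-- The admissible class `Γ_k` at level `μk`: radial measurable `a` with `μk ≺ a`, such that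
`Δu + a u = 0` has a nontrivial radial Neumann solution, and `a ∈ L^{N/2}(B_1)` if `N ≥ 3`,
or `a ∈ L^q(B_1)` for some `q ∈ (1,∞]` if `N = 2`. -/
def GammaSet (N : ℕ) (μk : ℝ) (a : ℝ → ℝ) : Prop :=
  Measurable a ∧ Prec μk a ∧
  (∃ u : ℝ → ℝ, IsRadialNeumannSolution N a u ∧ NontrivialSol u) ∧
  (if 3 ≤ N then RadialMemLp N ((N : ℝ) / 2) a
   else (∃ q : ℝ, 1 < q ∧ RadialMemLp N q a) ∨ RadialMemLinfty a)

/-- The Lyapunov constant `γ_{p,k}` for finite `p`. -/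
def gammaLyap (N : ℕ) (μk : ℝ) (p : ℝ) : ℝ :=
  sInf {t : ℝ | ∃ a : ℝ → ℝ, GammaSet N μk a ∧ RadialMemLp N p a ∧
    t = radialLpNorm N p (fun r => a r - μk)}

/-- The Lyapunov constant `γ_{∞,k}`. -/
def gammaLyapInfty (N : ℕ) (μk : ℝ) : ℝ :=
  sInf {t : ℝ | ∃ a : ℝ → ℝ, GammaSet N μk a ∧ RadialMemLinfty a ∧
    t = radialLinftyNorm (fun r => a r - μk)}

/-- `(μ, φ)` is the `k`-th radial Neumann eigenpair of `-Δ` on `B_1 ⊆ ℝ^N`: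
`μ ≥ 0`, `φ` is a nontrivial radial Neumann solution of `Δφ + μ φ = 0` having exactly `k`
zeros in `(0,1)`, all simple, given by `rz k < rz (k-1) < ⋯ < rz 1`. -/
def IsRadialNeumannEigenpair (N k : ℕ) (μ : ℝ) (φ : ℝ → ℝ) (rz : ℕ → ℝ) : Prop :=
  0 ≤ μ ∧
  IsRadialNeumannSolution N (fun _ => μ) φ ∧ NontrivialSol φ ∧
  (∀ i, 1 ≤ i → i ≤ k → rz i ∈ Ioo (0:ℝ) 1) ∧
  (∀ i j, 1 ≤ i → i < j → j ≤ k → rz j < rz i) ∧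
  (∀ x ∈ Ioo (0:ℝ) 1, (φ x = 0 ↔ ∃ i, 1 ≤ i ∧ i ≤ k ∧ x = rz i)) ∧
  (∀ i, 1 ≤ i → i ≤ k → ∃ d : ℝ, d ≠ 0 ∧ HasDerivAt φ d (rz i))

/-- `u` (with derivative `u'`) is a radial `H^1` solution of `Δu + a u = 0` in `B_1`:
continuous on `(0,1]`, differentiable on `(0,1)`, satisfying the integrated radial equation
between any two radii, with finite radial `H^1` energy. -/
def IsRadialH1Solution (N : ℕ) (a u u' : ℝ → ℝ) : Prop :=
  ContinuousOn u (Ioc 0 1) ∧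
  (∀ r ∈ Ioo (0:ℝ) 1, HasDerivAt u (u' r) r) ∧
  (∀ s ∈ Ioo (0:ℝ) 1, ∀ r ∈ Ioo (0:ℝ) 1, s < r →
    r ^ (N - 1) * u' r - s ^ (N - 1) * u' s
      = - ∫ t in s..r, t ^ (N - 1) * a t * u t) ∧
  IntegrableOn (fun r => r ^ (N - 1) * ((u' r) ^ 2 + (u r) ^ 2)) (Ioo (0:ℝ) 1)

/-- The Sobolev quotient: infimum of `(∫_{B_ρ} |∇w|²) / (∫_{B_ρ} |w|^q)^{2/q}` over nontrivial
`C^1` functions `w : ℝ^N → ℝ` with compact support contained in the ball `B_ρ`. -/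
def sobolevQuot (N : ℕ) (q : ℝ) (ρ : ℝ) : ℝ :=
  sInf {t : ℝ | ∃ w : EuclideanSpace ℝ (Fin N) → ℝ,
    ContDiff ℝ 1 w ∧ (∃ x, w x ≠ 0) ∧ tsupport w ⊆ Metric.ball 0 ρ ∧
    t = (∫ x in Metric.ball (0 : EuclideanSpace ℝ (Fin N)) ρ, ‖fderiv ℝ w x‖ ^ 2) /
        (∫ x in Metric.ball (0 : EuclideanSpace ℝ (Fin N)) ρ, |w x| ^ q) ^ (2 / q)}

open Topology

/-- The measure `r^(N-1) dr` on `(0,1)`. -/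
def radialMeasure (N : ℕ) : Measure ℝ :=
  (volume.restrict (Ioo (0:ℝ) 1)).withDensity (fun r => ENNReal.ofReal (r ^ (N - 1)))

lemma measurable_ofReal_pow (m : ℕ) : Measurable (fun r : ℝ => ENNReal.ofReal (r ^ m)) := by
  fun_prop

lemma integral_radialMeasure (N : ℕ) (f : ℝ → ℝ) :
    ∫ r, f r ∂(radialMeasure N) = ∫ r in Ioo (0:ℝ) 1, r ^ (N - 1) * f r := by
  rw [radialMeasure, integral_withDensity_eq_integral_toReal_smul (measurable_ofReal_pow _)
    (by simp)]
  refine setIntegral_congr_fun measurableSet_Ioo fun r hr => ?_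
  simp [ENNReal.toReal_ofReal (pow_nonneg hr.1.le (N - 1))]

lemma setIntegral_radialMeasure (N : ℕ) (f : ℝ → ℝ) {E : Set ℝ} (hE : MeasurableSet E) :
    ∫ r in E, f r ∂(radialMeasure N) = ∫ r in E ∩ Ioo (0:ℝ) 1, r ^ (N - 1) * f r := by
  rw [radialMeasure, restrict_withDensity hE,
    integral_withDensity_eq_integral_toReal_smul (measurable_ofReal_pow _)
    (by simp), Measure.restrict_restrict hE]
  refine setIntegral_congr_fun (hE.inter measurableSet_Ioo) fun r hr => ?_
  simp [ENNReal.toReal_ofReal (pow_nonneg hr.2.1.le (N - 1))]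

lemma integrable_radialMeasure_iff (N : ℕ) (f : ℝ → ℝ) :
    Integrable f (radialMeasure N) ↔ IntegrableOn (fun r => r ^ (N - 1) * f r) (Ioo (0:ℝ) 1) := by
  rw [radialMeasure, integrable_withDensity_iff_integrable_smul' (measurable_ofReal_pow _)
    (by simp)]
  refine integrableOn_congr_fun (fun r hr => ?_) measurableSet_Ioo
  simp [ENNReal.toReal_ofReal (pow_nonneg hr.1.le (N - 1))]

lemma ae_radialMeasure_iff (N : ℕ) (P : ℝ → Prop) :
    (∀ᵐ r ∂(radialMeasure N), P r) ↔ ∀ᵐ r ∂(volume.restrict (Ioo (0:ℝ) 1)), P r := by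
  rw [radialMeasure, ae_withDensity_iff (measurable_ofReal_pow _)]
  constructor <;> intro h
  · filter_upwards [h, ae_restrict_mem measurableSet_Ioo] with r hr hm
    exact hr (by simpa using pow_pos hm.1 _)
  · filter_upwards [h] with r hr _ using hr

lemma radialMeasure_absolutelyContinuous (N : ℕ) :
    radialMeasure N ≪ volume.restrict (Ioo (0:ℝ) 1) :=
  withDensity_absolutelyContinuous _ _

lemma ae_radialMeasure_mem (N : ℕ) : ∀ᵐ r ∂(radialMeasure N), r ∈ Ioo (0:ℝ) 1 := by
  rw [ae_radialMeasure_iff]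
  exact ae_restrict_mem measurableSet_Ioo

lemma Ioc_inter_Ioo_ae {s r : ℝ} (hs : 0 ≤ s) (hr : r ≤ 1) :
    (Ioc s r ∩ Ioo (0:ℝ) 1 : Set ℝ) =ᵐ[volume] Ioc s r := by
  have h1 : Ioo s r ⊆ Ioc s r ∩ Ioo (0:ℝ) 1 := fun x hx =>
    ⟨⟨hx.1, hx.2.le⟩, hs.trans_lt hx.1, hx.2.trans_le hr⟩
  refine Filter.EventuallyLE.antisymm (inter_subset_left.eventuallyLE) ?_
  exact (Ioo_ae_eq_Ioc (μ := volume)).symm.le.trans h1.eventuallyLE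

lemma intervalIntegral_eq_radialMeasure (N : ℕ) (f : ℝ → ℝ) {s r : ℝ} (hs : 0 ≤ s) (hsr : s ≤ r)
    (hr : r ≤ 1) :
    ∫ t in s..r, t ^ (N - 1) * f t = ∫ t in Ioc s r, f t ∂(radialMeasure N) := by
  rw [setIntegral_radialMeasure N f measurableSet_Ioc, intervalIntegral.integral_of_le hsr]
  exact (setIntegral_congr_set (Ioc_inter_Ioo_ae hs hr)).symm

lemma intervalIntegrable_of_radialMeasure {N : ℕ} {f : ℝ → ℝ}
    (hf : Integrable f (radialMeasure N)) {s r : ℝ} (hs : 0 ≤ s) (hsr : s ≤ r) (hr : r ≤ 1) :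
    IntervalIntegrable (fun t => t ^ (N - 1) * f t) volume s r := by
  rw [integrable_radialMeasure_iff] at hf
  rw [intervalIntegrable_iff_integrableOn_Ioc_of_le hsr]
  exact (hf.mono_set inter_subset_right).congr_set_ae (Ioc_inter_Ioo_ae hs hr).symm

lemma radialMeasure_Ioc_le (N : ℕ) {s r : ℝ} (hs : 0 ≤ s) (hsr : s ≤ r) :
    radialMeasure N (Ioc s r) ≤ ENNReal.ofReal (r ^ (N - 1) * (r - s)) := by
  rw [radialMeasure, withDensity_apply _ measurableSet_Ioc,
    Measure.restrict_restrict measurableSet_Ioc]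
  calc ∫⁻ t in Ioc s r ∩ Ioo (0:ℝ) 1, ENNReal.ofReal (t ^ (N - 1))
      ≤ ∫⁻ t in Ioc s r ∩ Ioo (0:ℝ) 1, ENNReal.ofReal (r ^ (N - 1)) := by
        refine setLIntegral_mono measurable_const fun t ht => ?_
        exact ENNReal.ofReal_le_ofReal (pow_le_pow_left₀ ht.2.1.le ht.1.2 _)
    _ ≤ ∫⁻ t in Ioc s r, ENNReal.ofReal (r ^ (N - 1)) :=
        lintegral_mono_set inter_subset_left
    _ = _ := by
        rw [setLIntegral_const, Real.volume_Ioc, ← ENNReal.ofReal_mul]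
        exact pow_nonneg (hs.trans hsr) _

lemma radialMeasure_univ_le (N : ℕ) : radialMeasure N univ ≤ 1 := by
  have h : radialMeasure N univ ≤ radialMeasure N (Ioc 0 1) := by
    refine measure_mono_ae ?_
    filter_upwards [ae_radialMeasure_mem N] with r hr _
    exact ⟨hr.1, hr.2.le⟩
  refine h.trans ((radialMeasure_Ioc_le N le_rfl zero_le_one).trans ?_)
  simp

instance (N : ℕ) : IsFiniteMeasure (radialMeasure N) :=
  ⟨(radialMeasure_univ_le N).trans_lt ENNReal.one_lt_top⟩

lemma radialMeasure_real_le_one (N : ℕ) (E : Set ℝ) : (radialMeasure N).real E ≤ 1 :=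
  ENNReal.toReal_le_of_le_ofReal zero_le_one
    (by simpa using (measure_mono (subset_univ E)).trans (radialMeasure_univ_le N))

lemma radialMeasure_real_Ioc_le (N : ℕ) {s r : ℝ} (hs : 0 ≤ s) (hsr : s ≤ r) :
    (radialMeasure N).real (Ioc s r) ≤ r ^ (N - 1) * (r - s) :=
  ENNReal.toReal_le_of_le_ofReal
    (mul_nonneg (pow_nonneg (hs.trans hsr) _) (sub_nonneg.2 hsr)) (radialMeasure_Ioc_le N hs hsr)

lemma ContinuousOn.aestronglyMeasurable_radialMeasure {u : ℝ → ℝ} (hu : ContinuousOn u (Icc 0 1))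
    (N : ℕ) : AEStronglyMeasurable u (radialMeasure N) := by
  refine AEStronglyMeasurable.mono_ac (radialMeasure_absolutelyContinuous N) ?_
  exact (hu.mono Ioo_subset_Icc_self).aestronglyMeasurable measurableSet_Ioo

lemma ContinuousOn.exists_abs_le {u : ℝ → ℝ} (hu : ContinuousOn u (Icc 0 1)) :
    ∃ C, 0 ≤ C ∧ ∀ r ∈ Icc (0:ℝ) 1, |u r| ≤ C := by
  obtain ⟨C, hC⟩ := isCompact_Icc.exists_bound_of_continuousOn hu
  exact ⟨C, (norm_nonneg _).trans (hC 0 (by simp)), hC⟩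

lemma MeasureTheory.Integrable.mul_continuousOn_radialMeasure {N : ℕ} {a u : ℝ → ℝ}
    (ha : Integrable a (radialMeasure N)) (hu : ContinuousOn u (Icc 0 1)) :
    Integrable (fun r => a r * u r) (radialMeasure N) := by
  obtain ⟨C, -, hC⟩ := hu.exists_abs_le
  refine ha.mul_bdd (c := C) (hu.aestronglyMeasurable_radialMeasure N) ?_
  filter_upwards [ae_radialMeasure_mem N] with r hr
  exact hC r (Ioo_subset_Icc_self hr)

/-- The first-order integral system satisfied on `[0,1]` by a radial solution `u` and its flux
`v = r^(N-1) u'`. -/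
structure RadialSystem (N : ℕ) (a u v : ℝ → ℝ) : Prop where
  cont : ContinuousOn u (Icc 0 1)
  flux : ∀ r ∈ Icc (0:ℝ) 1, v r = - ∫ t in Ioc 0 r, a t * u t ∂(radialMeasure N)
  sub_eq : ∀ s r, 0 < s → s ≤ r → r ≤ 1 → u r - u s = ∫ t in s..r, v t / t ^ (N - 1)
  neumann : v 1 = 0

section
variable {N : ℕ} {a u v : ℝ → ℝ}

lemma continuousOn_setIntegral_radialMeasure {f : ℝ → ℝ} (hf : Integrable f (radialMeasure N)) :
    ContinuousOn (fun r => ∫ t in Ioc 0 r, f t ∂(radialMeasure N)) (Icc 0 1) := by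
  have h := intervalIntegrable_of_radialMeasure hf le_rfl zero_le_one le_rfl
  have h1 := intervalIntegral.continuousOn_primitive_interval (μ := volume) (a := 0) (b := 1)
    (f := fun t => t ^ (N - 1) * f t) (by
      rwa [uIcc_of_le zero_le_one, integrableOn_Icc_iff_integrableOn_Ioc,
        ← intervalIntegrable_iff_integrableOn_Ioc_of_le zero_le_one])
  rw [uIcc_of_le zero_le_one] at h1
  refine h1.congr fun r hr => ?_
  exact (intervalIntegral_eq_radialMeasure N f le_rfl hr.1 hr.2).symm

namespace RadialSystem

lemma integrable_mul (h : RadialSystem N a u v) (ha : Integrable a (radialMeasure N)) :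
    Integrable (fun r => a r * u r) (radialMeasure N) :=
  ha.mul_continuousOn_radialMeasure h.cont

lemma continuousOn_flux (h : RadialSystem N a u v) (ha : Integrable a (radialMeasure N)) :
    ContinuousOn v (Icc 0 1) :=
  (continuousOn_setIntegral_radialMeasure (h.integrable_mul ha)).neg.congr h.flux

lemma flux_zero (h : RadialSystem N a u v) : v 0 = 0 := by
  rw [h.flux 0 (by simp)]; simp

lemma flux_sub (h : RadialSystem N a u v) (ha : Integrable a (radialMeasure N)) {s r : ℝ}
    (hs : 0 ≤ s) (hsr : s ≤ r) (hr : r ≤ 1) :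
    v r - v s = - ∫ t in Ioc s r, a t * u t ∂(radialMeasure N) := by
  rw [h.flux r ⟨hs.trans hsr, hr⟩, h.flux s ⟨hs, hsr.trans hr⟩, ← Ioc_union_Ioc_eq_Ioc hs hsr,
    setIntegral_union (Ioc_disjoint_Ioc_of_le le_rfl) measurableSet_Ioc
      (h.integrable_mul ha).integrableOn (h.integrable_mul ha).integrableOn]
  ring

lemma continuousOn_div (h : RadialSystem N a u v) (ha : Integrable a (radialMeasure N)) :
    ContinuousOn (fun t => v t / t ^ (N - 1)) (Ioc 0 1) :=
  ((h.continuousOn_flux ha).mono Ioc_subset_Icc_self).div (by fun_prop)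
    fun t ht => pow_ne_zero _ ht.1.ne'

lemma intervalIntegrable_div (h : RadialSystem N a u v) (ha : Integrable a (radialMeasure N))
    {s r : ℝ} (hs : 0 < s) (hsr : s ≤ r) (hr : r ≤ 1) :
    IntervalIntegrable (fun t => v t / t ^ (N - 1)) volume s r := by
  apply ContinuousOn.intervalIntegrable
  rw [uIcc_of_le hsr]
  exact (h.continuousOn_div ha).mono fun x hx => ⟨hs.trans_le hx.1, hx.2.trans hr⟩

lemma const_mul (h : RadialSystem N a u v) (c : ℝ) :
    RadialSystem N a (fun r => c * u r) (fun r => c * v r) where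
  cont := continuousOn_const.mul h.cont
  flux r hr := by
    rw [h.flux r hr, mul_neg, ← integral_const_mul]
    congr 2; ext t; ring
  sub_eq s r hs hsr hr := by
    rw [← mul_sub, h.sub_eq s r hs hsr hr, ← intervalIntegral.integral_const_mul]
    congr 1; ext t; ring
  neumann := by simp [h.neumann]

lemma hasDerivAt (h : RadialSystem N a u v) (ha : Integrable a (radialMeasure N)) {r : ℝ}
    (hr : r ∈ Ioo (0:ℝ) 1) : HasDerivAt u (v r / r ^ (N - 1)) r := by
  have hs : 0 < r / 2 := half_pos hr.1
  have h2 : r / 2 < r := half_lt_self hr.1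
  have hcont : ContinuousAt (fun t => v t / t ^ (N - 1)) r :=
    (h.continuousOn_div ha).continuousAt (Ioc_mem_nhds hr.1 hr.2)
  have hd := intervalIntegral.integral_hasDerivAt_right
    (h.intervalIntegrable_div ha hs h2.le hr.2.le)
    (((h.continuousOn_div ha).mono Ioo_subset_Ioc_self).stronglyMeasurableAtFilter isOpen_Ioo
      r hr) hcont
  refine (hd.const_add (u (r / 2))).congr_of_eventuallyEq ?_
  filter_upwards [Ioo_mem_nhds h2 hr.2] with x hx
  rw [← h.sub_eq (r / 2) x hs hx.1.le hx.2.le]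
  ring

end RadialSystem

lemma IsRadialNeumannSolution.exists_radialSystem (h : IsRadialNeumannSolution N a u)
    (ha : Integrable a (radialMeasure N)) : ∃ v, RadialSystem N a u v := by
  obtain ⟨u', hu, hd, hf, hn⟩ := h
  have hau := ha.mul_continuousOn_radialMeasure hu
  have key : ∀ r ∈ Ioc (0:ℝ) 1, r ^ (N - 1) * u' r =
      - ∫ t in Ioc 0 r, a t * u t ∂(radialMeasure N) := by
    intro r hr
    rw [hf r hr, ← intervalIntegral_eq_radialMeasure N _ le_rfl hr.1.le hr.2]
    congr 2; ext t; ring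
  have hc := continuousOn_setIntegral_radialMeasure hau
  have hc' : ContinuousOn u' (Ioc 0 1) := by
    have : ContinuousOn (fun r => (- ∫ t in Ioc 0 r, a t * u t ∂(radialMeasure N)) / r ^ (N - 1))
        (Ioc 0 1) :=
      (hc.neg.mono Ioc_subset_Icc_self).div (by fun_prop) fun t ht => pow_ne_zero _ ht.1.ne'
    refine this.congr fun r hr => ?_
    beta_reduce
    rw [← key r hr, mul_div_cancel_left₀ _ (pow_ne_zero _ hr.1.ne')]
  refine ⟨fun r => - ∫ t in Ioc 0 r, a t * u t ∂(radialMeasure N), hu, fun r _ => rfl, ?_, ?_⟩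
  · intro s r hs hsr hr
    have hInt : IntervalIntegrable u' volume s r := by
      apply ContinuousOn.intervalIntegrable
      rw [uIcc_of_le hsr]
      exact hc'.mono fun x hx => ⟨hs.trans_le hx.1, hx.2.trans hr⟩
    rw [← intervalIntegral.integral_eq_sub_of_hasDerivAt (f := u) (f' := u') (fun x hx => ?_) hInt]
    · refine intervalIntegral.integral_congr fun t ht => ?_
      rw [uIcc_of_le hsr] at ht
      have ht0 := hs.trans_le ht.1
      rw [← key t ⟨ht0, ht.2.trans hr⟩, mul_div_cancel_left₀ _ (pow_ne_zero _ ht0.ne')]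
    · rw [uIcc_of_le hsr] at hx
      exact hd x ⟨hs.trans_le hx.1, hx.2.trans hr⟩
  · rw [← key 1 (by simp), hn, mul_zero]

lemma RadialSystem.exists_isRadialNeumannSolution (h : RadialSystem N a u v)
    (ha : Integrable a (radialMeasure N)) :
    ∃ w, EqOn w u (Icc 0 1) ∧ IsRadialNeumannSolution N a w := by
  set V : ℝ → ℝ := fun t => v (max 0 (min t 1)) with hV
  have hVc : Continuous V := by
    refine (h.continuousOn_flux ha).comp_continuous (by fun_prop) fun t => ⟨le_max_left _ _, ?_⟩
    exact max_le zero_le_one (min_le_right _ _)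
  have hVeq : ∀ t ∈ Icc (0:ℝ) 1, V t = v t := fun t ht => by
    simp [hV, min_eq_left ht.2, max_eq_right ht.1]
  set F : ℝ → ℝ := fun t => V t / t ^ (N - 1) with hF
  have hFc : ContinuousOn F (Ioi 0) :=
    hVc.continuousOn.div (by fun_prop) fun t ht => pow_ne_zero _ (ne_of_gt ht)
  set w : ℝ → ℝ := fun r => if 0 < r then u 1 + ∫ t in (1:ℝ)..r, F t else u r with hw
  have hwu : EqOn w u (Icc 0 1) := by
    intro r hr
    rcases hr.1.eq_or_lt with h0 | h0
    · simp [hw, ← h0]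
    · have h1 := h.sub_eq r 1 h0 hr.2 le_rfl
      have h2 : ∫ t in r..(1:ℝ), F t = ∫ t in r..(1:ℝ), v t / t ^ (N - 1) := by
        refine intervalIntegral.integral_congr fun t ht => ?_
        rw [uIcc_of_le hr.2] at ht
        simp only [hF]
        rw [hVeq t ⟨h0.le.trans ht.1, ht.2⟩]
      simp only [hw, h0, if_true]
      rw [intervalIntegral.integral_symm, h2]
      linarith
  refine ⟨w, hwu, F, h.cont.congr hwu, ?_, ?_, ?_⟩
  · intro r hr
    have hInt : IntervalIntegrable F volume 1 r := by
      apply ContinuousOn.intervalIntegrable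
      exact hFc.mono fun x hx => (lt_min one_pos hr.1).trans_le hx.1
    have hd := intervalIntegral.integral_hasDerivAt_right hInt
      (hFc.stronglyMeasurableAtFilter isOpen_Ioi r hr.1) (hFc.continuousAt (Ioi_mem_nhds hr.1))
    refine (hd.const_add (u 1)).congr_of_eventuallyEq ?_
    filter_upwards [Ioi_mem_nhds hr.1] with x hx
    simp only [hw, if_pos (show 0 < x from hx)]
  · intro r hr
    simp only [hF]
    rw [mul_div_cancel₀ _ (pow_ne_zero _ hr.1.ne'), hVeq r ⟨hr.1.le, hr.2⟩,
      h.flux r ⟨hr.1.le, hr.2⟩, ← intervalIntegral_eq_radialMeasure N _ le_rfl hr.1.le hr.2]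
    congr 1
    refine intervalIntegral.integral_congr fun t ht => ?_
    rw [uIcc_of_le hr.1.le] at ht
    rw [hwu ⟨ht.1, ht.2.trans hr.2⟩]
    ring
  · simp [hF, hVeq 1 (by simp), h.neumann]

end

section
variable {N : ℕ} {μ : ℝ} {u v : ℝ → ℝ}

namespace RadialSystem

lemma hasDerivAt_flux_of_const (h : RadialSystem N (fun _ => μ) u v) {r : ℝ}
    (hr : r ∈ Ioo (0:ℝ) 1) : HasDerivAt v (-(r ^ (N - 1) * (μ * u r))) r := by
  have hi := h.integrable_mul (integrable_const μ)
  have hu : ContinuousOn (fun t => t ^ (N - 1) * (μ * u t)) (Ioo 0 1) := by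
    have := h.cont.mono Ioo_subset_Icc_self
    fun_prop
  have hd := intervalIntegral.integral_hasDerivAt_right
    (intervalIntegrable_of_radialMeasure hi le_rfl hr.1.le hr.2.le)
    (hu.stronglyMeasurableAtFilter isOpen_Ioo r hr) (hu.continuousAt (Ioo_mem_nhds hr.1 hr.2))
  refine hd.neg.congr_of_eventuallyEq ?_
  filter_upwards [Ioo_mem_nhds hr.1 hr.2] with x hx
  rw [h.flux x ⟨hx.1.le, hx.2.le⟩]
  simp only [Pi.neg_apply, neg_inj]
  exact (intervalIntegral_eq_radialMeasure N _ le_rfl hx.1.le hx.2.le).symm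

/-- The energy `u'² + μ u²` is nonincreasing. -/
lemma antitoneOn_energy (h : RadialSystem N (fun _ => μ) u v) :
    AntitoneOn (fun r => (v r / r ^ (N - 1)) ^ 2 + μ * u r ^ 2) (Ioc 0 1) := by
  have ha : Integrable (fun _ : ℝ => μ) (radialMeasure N) := integrable_const μ
  have hd : ∀ r ∈ Ioo (0:ℝ) 1, HasDerivAt (fun r => (v r / r ^ (N - 1)) ^ 2 + μ * u r ^ 2)
      (-(2 * ((N - 1 : ℕ) : ℝ) / r * (v r / r ^ (N - 1)) ^ 2)) r := by
    intro r hr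
    have hp : r ^ (N - 1) ≠ 0 := pow_ne_zero _ hr.1.ne'
    have hv := (((h.hasDerivAt_flux_of_const hr).fun_div (hasDerivAt_pow (N - 1) r) hp).fun_pow 2).fun_add
      (((h.hasDerivAt ha hr).fun_pow 2).const_mul μ)
    refine hv.congr_deriv ?_
    have hr0 : r ≠ 0 := hr.1.ne'
    rcases Nat.eq_zero_or_pos (N - 1) with h0 | h0
    · simp [h0]; ring
    · obtain ⟨m, hm⟩ : ∃ m, N - 1 = m + 1 := ⟨N - 2, by omega⟩
      simp only [hm, Nat.add_sub_cancel, Nat.reduceSub, pow_one, Nat.cast_ofNat]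
      field_simp
      ring
  refine antitoneOn_of_deriv_nonpos (convex_Ioc 0 1) ?_ ?_ ?_
  · have h1 := h.continuousOn_div ha
    have h2 := h.cont.mono Ioc_subset_Icc_self
    exact (h1.pow 2).add (continuousOn_const.mul (h2.pow 2))
  · rw [interior_Ioc]
    exact fun r hr => (hd r hr).differentiableAt.differentiableWithinAt
  · rw [interior_Ioc]
    intro r hr
    rw [(hd r hr).deriv, neg_nonpos]
    have := hr.1
    positivity

/-- The rescaled energy `r^(2(N-1)) (u'² + μ u²)` is nondecreasing. -/
lemma monotoneOn_scaledEnergy (h : RadialSystem N (fun _ => μ) u v) (hμ : 0 ≤ μ) :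
    MonotoneOn (fun r => v r ^ 2 + μ * (r ^ (N - 1) * u r) ^ 2) (Ioc 0 1) := by
  have ha : Integrable (fun _ : ℝ => μ) (radialMeasure N) := integrable_const μ
  have hd : ∀ r ∈ Ioo (0:ℝ) 1, HasDerivAt (fun r => v r ^ 2 + μ * (r ^ (N - 1) * u r) ^ 2)
      (2 * ((N - 1 : ℕ) : ℝ) * μ / r * (r ^ (N - 1) * u r) ^ 2) r := by
    intro r hr
    have hv := ((h.hasDerivAt_flux_of_const hr).fun_pow 2).fun_add
      ((((hasDerivAt_pow (N - 1) r).fun_mul (h.hasDerivAt ha hr)).fun_pow 2).const_mul μ)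
    refine hv.congr_deriv ?_
    have hr0 : r ≠ 0 := hr.1.ne'
    rcases Nat.eq_zero_or_pos (N - 1) with h0 | h0
    · simp [h0]; ring
    · obtain ⟨m, hm⟩ : ∃ m, N - 1 = m + 1 := ⟨N - 2, by omega⟩
      simp only [hm, Nat.add_sub_cancel, Nat.reduceSub, pow_one, Nat.cast_ofNat]
      field_simp
      ring
  refine monotoneOn_of_deriv_nonneg (convex_Ioc 0 1) ?_ ?_ ?_
  · have h1 := (h.continuousOn_flux ha).mono Ioc_subset_Icc_self
    have h2 := h.cont.mono Ioc_subset_Icc_self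
    exact (h1.pow 2).add (continuousOn_const.mul (((continuousOn_pow (N - 1)).mul h2).pow 2))
  · rw [interior_Ioc]
    exact fun r hr => (hd r hr).differentiableAt.differentiableWithinAt
  · rw [interior_Ioc]
    intro r hr
    rw [(hd r hr).deriv]
    have := hr.1
    positivity

lemma tendsto_flux_div_zero (h : RadialSystem N (fun _ => μ) u v) :
    Tendsto (fun r => v r / r ^ (N - 1)) (𝓝[>] 0) (𝓝 0) := by
  obtain ⟨C, hC0, hC⟩ := h.cont.exists_abs_le
  have hb : ∀ r ∈ Ioo (0:ℝ) 1, ‖v r / r ^ (N - 1)‖ ≤ |μ| * C * r := by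
    intro r hr
    have hp : 0 < r ^ (N - 1) := pow_pos hr.1 _
    rw [norm_div, Real.norm_of_nonneg hp.le, div_le_iff₀ hp, h.flux r ⟨hr.1.le, hr.2.le⟩, norm_neg]
    refine (norm_setIntegral_le_of_norm_le_const (C := |μ| * C) (measure_lt_top _ _)
      fun t ht => ?_).trans ?_
    · rw [norm_mul]
      exact mul_le_mul_of_nonneg_left (hC t ⟨ht.1.le, ht.2.trans hr.2.le⟩) (norm_nonneg μ)
    · rw [mul_assoc _ r]
      refine mul_le_mul_of_nonneg_left ?_ (by positivity)
      refine (radialMeasure_real_Ioc_le N le_rfl hr.1.le).trans (le_of_eq (by ring))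
  refine squeeze_zero_norm' (a := fun r => |μ| * C * r) ?_ ?_
  · filter_upwards [Ioo_mem_nhdsGT zero_lt_one] with r hr using hb r hr
  · have : Tendsto (fun r : ℝ => |μ| * C * r) (𝓝 0) (𝓝 (|μ| * C * 0)) := by
      exact (continuous_const.mul continuous_id).tendsto 0
    simpa using this.mono_left nhdsWithin_le_nhds

lemma eq_const_of_flux_eq_zero {a : ℝ → ℝ} (h : RadialSystem N a u v)
    (hv : ∀ r ∈ Ioc (0:ℝ) 1, v r = 0) : ∀ r ∈ Icc (0:ℝ) 1, u r = u 1 := by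
  have h1 : ∀ r ∈ Ioc (0:ℝ) 1, u r = u 1 := by
    intro r hr
    have h2 := h.sub_eq r 1 hr.1 hr.2 le_rfl
    have h3 : ∫ t in r..(1:ℝ), v t / t ^ (N - 1) = ∫ t in r..(1:ℝ), (0:ℝ) := by
      refine intervalIntegral.integral_congr fun t ht => ?_
      rw [uIcc_of_le hr.2] at ht
      simp [hv t ⟨hr.1.trans_le ht.1, ht.2⟩]
    rw [h3] at h2
    simp at h2
    linarith
  intro r hr
  rcases hr.1.eq_or_lt with h0 | h0
  · subst h0
    have hc : Tendsto u (𝓝[>] 0) (𝓝 (u 0)) := by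
      have := (h.cont 0 hr).mono_left (nhdsWithin_mono 0 Ioc_subset_Icc_self)
      rwa [nhdsWithin_Ioc_eq_nhdsGT zero_lt_one] at this
    have hc' : Tendsto u (𝓝[>] 0) (𝓝 (u 1)) := by
      refine tendsto_const_nhds.congr' ?_
      filter_upwards [Ioc_mem_nhdsGT zero_lt_one] with r hr using (h1 r hr).symm
    exact tendsto_nhds_unique hc hc'
  · exact h1 r ⟨h0, hr.2⟩

/-- A nontrivial solution for a constant nonnegative potential never has `u = v = 0`. -/
lemma ne_zero_or_flux_ne_zero (h : RadialSystem N (fun _ => μ) u v) (hμ : 0 ≤ μ)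
    (hu : ∃ r ∈ Icc (0:ℝ) 1, u r ≠ 0) {x : ℝ} (hx : x ∈ Icc (0:ℝ) 1) : u x ≠ 0 ∨ v x ≠ 0 := by
  by_contra! hc
  obtain ⟨hux, hvx⟩ := hc
  have hanti := h.antitoneOn_energy
  have hE : ∀ r ∈ Ioc (0:ℝ) 1, (v r / r ^ (N - 1)) ^ 2 + μ * u r ^ 2 ≤ 0 → v r = 0 := by
    intro r hr hle
    have h1 : 0 ≤ μ * u r ^ 2 := by positivity
    have h2 : (v r / r ^ (N - 1)) ^ 2 = 0 := le_antisymm (by linarith) (sq_nonneg _)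
    have h3 : v r / r ^ (N - 1) = 0 := by simpa using h2
    exact (div_eq_zero_iff.1 h3).resolve_right (pow_ne_zero _ hr.1.ne')
  have hv : ∀ r ∈ Ioc (0:ℝ) 1, v r = 0 := by
    rcases hx.1.eq_or_lt with h0 | h0
    · subst h0
      intro r hr
      refine hE r hr ?_
      have hc : Tendsto u (𝓝[>] 0) (𝓝 (u 0)) := by
        have := (h.cont 0 hx).mono_left (nhdsWithin_mono 0 Ioc_subset_Icc_self)
        rwa [nhdsWithin_Ioc_eq_nhdsGT zero_lt_one] at this
      have ht : Tendsto (fun r => (v r / r ^ (N - 1)) ^ 2 + μ * u r ^ 2) (𝓝[>] 0) (𝓝 0) := by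
        have := (h.tendsto_flux_div_zero.pow 2).add ((hc.pow 2).const_mul μ)
        simpa [hux] using this
      refine ge_of_tendsto ht ?_
      filter_upwards [Ioo_mem_nhdsGT hr.1] with s hs
      exact hanti ⟨hs.1, hs.2.le.trans hr.2⟩ hr hs.2.le
    · intro r hr
      rcases le_total x r with hxr | hrx
      · refine hE r hr ((hanti ⟨h0, hx.2⟩ hr hxr).trans ?_)
        simp [hux, hvx]
      · have h1 := h.monotoneOn_scaledEnergy hμ hr ⟨h0, hx.2⟩ hrx
        simp only [hux, hvx] at h1
        have h2 : 0 ≤ μ * (r ^ (N - 1) * u r) ^ 2 := by positivity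
        have h3 : v r ^ 2 = 0 := le_antisymm (by norm_num at h1; linarith) (sq_nonneg _)
        simpa using h3
  have hconst := h.eq_const_of_flux_eq_zero hv
  obtain ⟨r, hr, hne⟩ := hu
  exact hne (by rw [hconst r hr, ← hconst x hx, hux])

end RadialSystem
end

/-- Product rule for indefinite integrals of integrable functions. -/
lemma mul_sub_mul_eq_integral {F G f g : ℝ → ℝ} {s r : ℝ} (hsr : s ≤ r)
    (hf : IntervalIntegrable f volume s r) (hg : IntervalIntegrable g volume s r)
    (hF : ∀ x ∈ Icc s r, F x = F s + ∫ t in s..x, f t)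
    (hG : ∀ x ∈ Icc s r, G x = G s + ∫ t in s..x, g t) :
    F r * G r - F s * G s = ∫ t in s..r, (f t * G t + F t * g t) := by
  have hFac := hf.absolutelyContinuousOnInterval_intervalIntegral (c := s) (by simp)
  have hGac := hg.absolutelyContinuousOnInterval_intervalIntegral (c := s) (by simp)
  have hprod := hFac.integral_deriv_mul_eq_sub hGac
  have hFc := hFac.continuousOn
  have hGc := hGac.continuousOn
  have h1 : ∫ x in s..r, (deriv (fun x => ∫ v in s..x, f v) x * (∫ v in s..x, g v) +
      (∫ v in s..x, f v) * deriv (fun x => ∫ v in s..x, g v) x) =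
      ∫ x in s..r, (f x * (∫ v in s..x, g v) + (∫ v in s..x, f v) * g x) := by
    apply intervalIntegral.integral_congr_ae
    filter_upwards [hf.ae_hasDerivAt_integral, hg.ae_hasDerivAt_integral] with x hx1 hx2 hx
    rw [(hx1 (uIoc_subset_uIcc hx) s (by simp)).deriv,
      (hx2 (uIoc_subset_uIcc hx) s (by simp)).deriv]
  rw [h1] at hprod
  have i1 : IntervalIntegrable (fun x => f x * (∫ v in s..x, g v) + (∫ v in s..x, f v) * g x)
      volume s r := (hf.mul_continuousOn hGc).add (hg.continuousOn_mul hFc)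
  have h2 : ∫ t in s..r, (f t * G t + F t * g t) =
      ∫ t in s..r, ((f t * G s + F s * g t) +
        (f t * (∫ v in s..t, g v) + (∫ v in s..t, f v) * g t)) := by
    refine intervalIntegral.integral_congr fun t ht => ?_
    rw [uIcc_of_le hsr] at ht
    rw [hF t ht, hG t ht]
    ring
  rw [h2, intervalIntegral.integral_add ((hf.mul_const _).add (hg.const_mul _)) i1, hprod,
    intervalIntegral.integral_add (hf.mul_const _) (hg.const_mul _),
    intervalIntegral.integral_mul_const, intervalIntegral.integral_const_mul,
    hF r ⟨hsr, le_rfl⟩, hG r ⟨hsr, le_rfl⟩]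
  simp
  ring

lemma nonpos_of_integral_eq {W g q : ℝ → ℝ} {K : ℝ} (hK : 0 ≤ K)
    (hW : ContinuousOn W (Icc 0 1)) (hq : ContinuousOn q (Icc 0 1)) (hg0 : ∀ x, 0 ≤ g x)
    (hg : IntervalIntegrable g volume 0 1) (hW0 : W 0 = 0)
    (hInt : ∀ s r, 0 ≤ s → s ≤ r → r ≤ 1 → W r - W s = - ∫ t in s..r, g t * q t)
    (hqW : ∀ r ∈ Icc (0:ℝ) 1, q r ≤ 0 → |q r| ≤ K * |W r|) :
    ∀ t ∈ Icc (0:ℝ) 1, W t ≤ 0 := by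
  intro t ht
  by_contra! hpos
  have hsub : ∀ {a b : ℝ}, 0 ≤ a → a ≤ b → b ≤ 1 → uIcc a b ⊆ Icc 0 1 := fun ha hab hb => by
    rw [uIcc_of_le hab]; exact Icc_subset_Icc ha hb
  have hgi : ∀ {a b : ℝ}, 0 ≤ a → a ≤ b → b ≤ 1 → IntervalIntegrable g volume a b :=
    fun ha hab hb => hg.mono_set (by rw [uIcc_of_le zero_le_one]; exact hsub ha hab hb)
  obtain ⟨s, ⟨⟨hs0, hst⟩, hWs⟩, hsmax⟩ : ∃ s, IsGreatest {x ∈ Icc 0 t | W x ≤ 0} s := by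
    have hc : IsClosed {x ∈ Icc 0 t | W x ≤ 0} :=
      ContinuousOn.preimage_isClosed_of_isClosed (hW.mono (Icc_subset_Icc_right ht.2)) isClosed_Icc
        (isClosed_Iic (a := (0:ℝ)))
    refine (isCompact_Icc.of_isClosed_subset hc (sep_subset _ _)).exists_isGreatest ?_
    exact ⟨0, ⟨le_rfl, ht.1⟩, hW0.le⟩
  have hslt : s < t := hst.lt_of_ne (fun h => absurd (h ▸ hWs) (not_le.2 hpos))
  have hWpos : ∀ x ∈ Ioc s t, 0 < W x := by
    intro x hx
    by_contra! hle
    exact absurd (hsmax ⟨⟨hs0.trans hx.1.le, hx.2⟩, hle⟩) (not_le.2 hx.1)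
  have hst1 : s ≤ 1 := hst.trans ht.2
  have hprim : Tendsto (fun x => K * ∫ y in s..x, g y) (𝓝[>] s) (𝓝 0) := by
    have h1 := intervalIntegral.continuousOn_primitive_interval (μ := volume) (a := s) (b := t)
      (f := g) (by
        rw [uIcc_of_le hst, integrableOn_Icc_iff_integrableOn_Ioc,
          ← intervalIntegrable_iff_integrableOn_Ioc_of_le hst]
        exact hgi hs0 hst ht.2)
    rw [uIcc_of_le hst] at h1
    have h2 := ((h1 s ⟨le_rfl, hst⟩).mono_left (nhdsWithin_mono s Ioc_subset_Icc_self)).const_mul K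
    rw [nhdsWithin_Ioc_eq_nhdsGT hslt] at h2
    simpa using h2
  obtain ⟨t', ht'small, ht'⟩ := ((hprim.eventually (gt_mem_nhds (half_pos one_pos))).and
    (Ioc_mem_nhdsGT hslt)).exists
  have ht'1 : t' ≤ 1 := ht'.2.trans ht.2
  obtain ⟨m, hm, hmax⟩ := isCompact_Icc.exists_isMaxOn (nonempty_Icc.2 ht'.1.le)
    (hW.mono (Icc_subset_Icc hs0 ht'1))
  have hWm : 0 < W m := (hWpos t' ht').trans_le (hmax ⟨ht'.1.le, le_rfl⟩)
  have hm1 : m ≤ 1 := hm.2.trans ht'1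
  have hle : W m - W s ≤ (∫ y in s..m, g y) * (K * W m) := by
    rw [hInt s m hs0 hm.1 hm1, ← intervalIntegral.integral_neg,
      ← intervalIntegral.integral_mul_const]
    refine intervalIntegral.integral_mono_on_of_le_Ioo hm.1
      (((hgi hs0 hm.1 hm1).mul_continuousOn (hq.mono (hsub hs0 hm.1 hm1))).neg)
      ((hgi hs0 hm.1 hm1).mul_const _) fun y hy => ?_
    have hyW : 0 < W y := hWpos y ⟨hy.1, hy.2.le.trans (hm.2.trans ht'.2)⟩
    have hym : W y ≤ W m := hmax ⟨hy.1.le, hy.2.le.trans hm.2⟩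
    rw [← mul_neg]
    refine mul_le_mul_of_nonneg_left ?_ (hg0 y)
    rcases le_total (q y) 0 with hqy | hqy
    · have := hqW y ⟨hs0.trans hy.1.le, hy.2.le.trans hm1⟩ hqy
      rw [abs_of_pos hyW] at this
      exact (neg_le_abs _).trans (this.trans (mul_le_mul_of_nonneg_left hym hK))
    · have := mul_nonneg hK hWm.le
      linarith
  have hmono : ∫ y in s..m, g y ≤ ∫ y in s..t', g y :=
    intervalIntegral.integral_mono_interval le_rfl hm.1 hm.2 (ae_of_all _ hg0)
      (hgi hs0 ht'.1.le ht'1)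
  nlinarith [mul_le_mul_of_nonneg_right hmono (mul_nonneg hK hWm.le)]

lemma eq_zero_of_integral_eq {W g q : ℝ → ℝ} {K : ℝ} (hK : 0 ≤ K)
    (hW : ContinuousOn W (Icc 0 1)) (hq : ContinuousOn q (Icc 0 1)) (hg0 : ∀ x, 0 ≤ g x)
    (hg : IntervalIntegrable g volume 0 1) (hW0 : W 0 = 0) (hW1 : W 1 = 0)
    (hInt : ∀ s r, 0 ≤ s → s ≤ r → r ≤ 1 → W r - W s = - ∫ t in s..r, g t * q t)
    (hqW : ∀ r ∈ Icc (0:ℝ) 1, q r ≤ 0 → |q r| ≤ K * |W r|) :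
    ∀ t ∈ Icc (0:ℝ) 1, W t = 0 := by
  intro t ht
  refine le_antisymm (nonpos_of_integral_eq hK hW hq hg0 hg hW0 hInt hqW t ht) ?_
  have hmaps : MapsTo (fun x : ℝ => 1 - x) (Icc 0 1) (Icc 0 1) := fun x hx => by
    constructor <;> [linarith [hx.2]; linarith [hx.1]]
  have hsub : ContinuousOn (fun x : ℝ => 1 - x) (Icc 0 1) := by fun_prop
  have h := nonpos_of_integral_eq (W := fun x => - W (1 - x)) (g := fun x => g (1 - x))
    (q := fun x => q (1 - x)) hK (hW.comp hsub hmaps).neg (hq.comp hsub hmaps)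
    (fun x => hg0 _) (by simpa using (hg.comp_sub_left 1).symm) (by simp [hW1]) ?_ ?_ (1 - t)
    (hmaps ht)
  · simp only [sub_sub_cancel] at h
    linarith
  · intro s r hs hsr hr
    have h1 := hInt (1 - r) (1 - s) (by linarith) (by linarith) (by linarith)
    rw [intervalIntegral.integral_comp_sub_left (fun x => g x * q x), ← h1]
    ring
  · intro r hr hqr
    rw [abs_neg]
    exact hqW _ (hmaps hr) hqr

section
variable {N : ℕ} {μ : ℝ} {a u v u₀ v₀ : ℝ → ℝ}

lemma RadialSystem.eq_add_integral (h : RadialSystem N a u v)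
    {s r : ℝ} (hs : 0 < s) (hr : r ≤ 1) :
    ∀ x ∈ Icc s r, u x = u s + ∫ t in s..x, v t / t ^ (N - 1) := fun x hx => by
  rw [← h.sub_eq s x hs hx.1 (hx.2.trans hr)]; ring

lemma RadialSystem.flux_eq_add_integral (h : RadialSystem N a u v)
    (ha : Integrable a (radialMeasure N)) {s r : ℝ} (hs : 0 ≤ s) (hr : r ≤ 1) :
    ∀ x ∈ Icc s r, v x = v s + ∫ t in s..x, -(t ^ (N - 1) * (a t * u t)) := fun x hx => by
  rw [intervalIntegral.integral_neg,
    intervalIntegral_eq_radialMeasure N (fun t => a t * u t) hs hx.1 (hx.2.trans hr),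
    ← h.flux_sub ha hs hx.1 (hx.2.trans hr)]
  ring

lemma RadialSystem.wronskian_sub_of_pos (h : RadialSystem N a u v)
    (h₀ : RadialSystem N (fun _ => μ) u₀ v₀) (ha : Integrable a (radialMeasure N)) {s r : ℝ}
    (hs : 0 < s) (hsr : s ≤ r) (hr : r ≤ 1) :
    (v r * u₀ r - u r * v₀ r) - (v s * u₀ s - u s * v₀ s) =
      - ∫ t in s..r, (t ^ (N - 1) * (a t - μ)) * (u t * u₀ t) := by
  have hμ : Integrable (fun _ : ℝ => μ) (radialMeasure N) := integrable_const μ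
  have iv := (intervalIntegrable_of_radialMeasure (h.integrable_mul ha) hs.le hsr hr).neg
  have iv₀ := (intervalIntegrable_of_radialMeasure (h₀.integrable_mul hμ) hs.le hsr hr).neg
  have iu := h.intervalIntegrable_div ha hs hsr hr
  have iu₀ := h₀.intervalIntegrable_div hμ hs hsr hr
  have hsub : uIcc s r ⊆ Icc 0 1 := by rw [uIcc_of_le hsr]; exact Icc_subset_Icc hs.le hr
  have e1 := mul_sub_mul_eq_integral hsr iv iu₀ (h.flux_eq_add_integral ha hs.le hr)
    (h₀.eq_add_integral hs hr)
  have e2 := mul_sub_mul_eq_integral hsr iu iv₀ (h.eq_add_integral hs hr)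
    (h₀.flux_eq_add_integral hμ hs.le hr)
  have j1 := (iv.mul_continuousOn (h₀.cont.mono hsub)).add
    (iu₀.continuousOn_mul ((h.continuousOn_flux ha).mono hsub))
  have j2 := (iu.mul_continuousOn ((h₀.continuousOn_flux hμ).mono hsub)).add
    (iv₀.continuousOn_mul (h.cont.mono hsub))
  have e3 := intervalIntegral.integral_sub j1 j2
  calc _ = (v r * u₀ r - v s * u₀ s) - (u r * v₀ r - u s * v₀ s) := by ring
    _ = _ := by
      rw [e1, e2, ← intervalIntegral.integral_neg]
      refine e3.symm.trans (intervalIntegral.integral_congr fun t _ => ?_)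
      simp only [Pi.neg_apply]
      ring

lemma RadialSystem.wronskian_sub (h : RadialSystem N a u v)
    (h₀ : RadialSystem N (fun _ => μ) u₀ v₀) (ha : Integrable a (radialMeasure N)) {s r : ℝ}
    (hs : 0 ≤ s) (hsr : s ≤ r) (hr : r ≤ 1) :
    (v r * u₀ r - u r * v₀ r) - (v s * u₀ s - u s * v₀ s) =
      - ∫ t in s..r, (t ^ (N - 1) * (a t - μ)) * (u t * u₀ t) := by
  have hμ : Integrable (fun _ : ℝ => μ) (radialMeasure N) := integrable_const μ
  rcases hs.eq_or_lt with h0 | h0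
  swap
  · exact h.wronskian_sub_of_pos h₀ ha h0 hsr hr
  subst h0
  rcases hsr.eq_or_lt with h1 | h1
  · simp [← h1]
  have hcW : ContinuousOn (fun s => v s * u₀ s - u s * v₀ s) (Icc 0 1) :=
    ((h.continuousOn_flux ha).mul h₀.cont).sub (h.cont.mul (h₀.continuousOn_flux hμ))
  have hi : Integrable (fun t => (a t - μ) * (u t * u₀ t)) (radialMeasure N) :=
    (ha.sub hμ).mul_continuousOn_radialMeasure (h.cont.mul h₀.cont)
  have hsplit : ∀ s ∈ Icc 0 r, ∫ t in s..r, (t ^ (N - 1) * (a t - μ)) * (u t * u₀ t) =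
      (∫ t in Ioc 0 r, (a t - μ) * (u t * u₀ t) ∂(radialMeasure N)) -
      ∫ t in Ioc 0 s, (a t - μ) * (u t * u₀ t) ∂(radialMeasure N) := by
    intro s hs
    have hs1 := hs.2.trans hr
    rw [← intervalIntegral_eq_radialMeasure N _ le_rfl h1.le hr,
      ← intervalIntegral_eq_radialMeasure N _ le_rfl hs.1 hs1,
      intervalIntegral.integral_interval_sub_left
        (intervalIntegrable_of_radialMeasure hi le_rfl h1.le hr)
        (intervalIntegrable_of_radialMeasure hi le_rfl hs.1 hs1)]
    congr 1; ext t; ring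
  have hlim : ∀ f : ℝ → ℝ, ContinuousOn f (Icc 0 1) → Tendsto f (𝓝[>] 0) (𝓝 (f 0)) := by
    intro f hf
    have := (hf 0 (by simp)).mono_left (nhdsWithin_mono 0 Ioc_subset_Icc_self)
    rwa [nhdsWithin_Ioc_eq_nhdsGT zero_lt_one] at this
  have l1 := (hlim _ hcW).const_sub (v r * u₀ r - u r * v₀ r)
  have l2 := ((hlim _ (continuousOn_setIntegral_radialMeasure hi)).const_sub
    (∫ t in Ioc 0 r, (a t - μ) * (u t * u₀ t) ∂(radialMeasure N))).neg
  rw [hsplit 0 ⟨le_rfl, h1.le⟩]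
  refine tendsto_nhds_unique l1 (l2.congr' ?_)
  filter_upwards [Ioo_mem_nhdsGT h1] with s hs
  rw [← hsplit s ⟨hs.1.le, hs.2.le⟩]
  exact (h.wronskian_sub_of_pos h₀ ha hs.1 hs.2.le hr).symm

/-- If `a ≥ μ` and the solution `(u, v)` for `a` is related to a solution for `μ` by a
Wronskian bound, then `a = μ` almost everywhere. -/
lemma RadialSystem.ae_eq_of_wronskian_bound (h : RadialSystem N a u v)
    (h₀ : RadialSystem N (fun _ => μ) u₀ v₀) (ha : Integrable a (radialMeasure N))
    (haμ : ∀ᵐ r ∂(radialMeasure N), μ ≤ a r) {K : ℝ} (hK : 0 ≤ K)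
    (hb : ∀ r ∈ Icc (0:ℝ) 1, u r * u₀ r ≤ 0 → |u r * u₀ r| ≤ K * |v r * u₀ r - u r * v₀ r|)
    (hz : ∀ r ∈ Icc (0:ℝ) 1, u r * u₀ r = 0 → v r * u₀ r - u r * v₀ r = 0 → u₀ r = 0)
    (hne : ∀ᵐ r ∂(radialMeasure N), u₀ r ≠ 0) :
    ∀ᵐ r ∂(radialMeasure N), a r = μ := by
  have hμ : Integrable (fun _ : ℝ => μ) (radialMeasure N) := integrable_const μ
  set b : ℝ → ℝ := fun r => max (a r - μ) 0 with hbdef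
  have hbi : Integrable b (radialMeasure N) := (ha.sub hμ).pos_part
  have hab : ∀ᵐ r ∂(radialMeasure N), a r - μ = b r := by
    filter_upwards [haμ] with r hr
    simp [hbdef, max_eq_left (sub_nonneg.2 hr)]
  have hq : ContinuousOn (fun r => u r * u₀ r) (Icc 0 1) := h.cont.mul h₀.cont
  have hW : ContinuousOn (fun s => v s * u₀ s - u s * v₀ s) (Icc 0 1) :=
    ((h.continuousOn_flux ha).mul h₀.cont).sub (h.cont.mul (h₀.continuousOn_flux hμ))
  have hWb : ∀ s r, 0 ≤ s → s ≤ r → r ≤ 1 →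
      (v r * u₀ r - u r * v₀ r) - (v s * u₀ s - u s * v₀ s) =
      - ∫ t in s..r, (|t| ^ (N - 1) * b t) * (u t * u₀ t) := by
    intro s r hs hsr hr
    rw [h.wronskian_sub h₀ ha hs hsr hr]
    have e1 : ∫ t in s..r, (t ^ (N - 1) * (a t - μ)) * (u t * u₀ t) =
        ∫ t in s..r, t ^ (N - 1) * ((a t - μ) * (u t * u₀ t)) := by
      congr 1; ext t; ring
    have e2 : ∫ t in s..r, (|t| ^ (N - 1) * b t) * (u t * u₀ t) =
        ∫ t in s..r, t ^ (N - 1) * (b t * (u t * u₀ t)) := by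
      refine intervalIntegral.integral_congr fun t ht => ?_
      rw [uIcc_of_le hsr] at ht
      rw [abs_of_nonneg (hs.trans ht.1)]
      ring
    rw [e1, e2, intervalIntegral_eq_radialMeasure N _ hs hsr hr,
      intervalIntegral_eq_radialMeasure N _ hs hsr hr]
    congr 1
    refine integral_congr_ae (ae_restrict_of_ae ?_)
    filter_upwards [hab] with t ht
    rw [ht]
  have hgi : IntervalIntegrable (fun t => |t| ^ (N - 1) * b t) volume 0 1 := by
    have := intervalIntegrable_of_radialMeasure hbi le_rfl zero_le_one le_rfl
    refine this.congr fun t ht => ?_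
    rw [uIoc_of_le zero_le_one] at ht
    rw [abs_of_nonneg ht.1.le]
  have hW0 := eq_zero_of_integral_eq hK hW hq
    (fun x => mul_nonneg (by positivity) (le_max_right _ _)) hgi
    (by simp [h.flux_zero, h₀.flux_zero]) (by simp [h.neumann, h₀.neumann]) hWb hb
  have hq0 : ∀ r ∈ Icc (0:ℝ) 1, 0 ≤ u r * u₀ r := by
    intro r hr
    by_contra! hlt
    have h1 := hb r hr hlt.le
    rw [hW0 r hr, abs_zero, mul_zero] at h1
    exact hlt.ne (abs_eq_zero.1 (le_antisymm h1 (abs_nonneg _)))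
  have hi : Integrable (fun t => b t * (u t * u₀ t)) (radialMeasure N) :=
    hbi.mul_continuousOn_radialMeasure hq
  have hInt : ∫ t, b t * (u t * u₀ t) ∂(radialMeasure N) = 0 := by
    have h1 := hWb 0 1 le_rfl zero_le_one le_rfl
    rw [hW0 1 (by simp), hW0 0 (by simp)] at h1
    rw [integral_radialMeasure, ← integral_Ioc_eq_integral_Ioo,
      ← intervalIntegral.integral_of_le zero_le_one]
    have e2 : ∫ t in (0:ℝ)..1, (|t| ^ (N - 1) * b t) * (u t * u₀ t) =
        ∫ t in (0:ℝ)..1, t ^ (N - 1) * (b t * (u t * u₀ t)) := by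
      refine intervalIntegral.integral_congr fun t ht => ?_
      rw [uIcc_of_le zero_le_one] at ht
      rw [abs_of_nonneg ht.1]
      ring
    rw [← e2]
    linarith
  have hae : 0 ≤ᵐ[radialMeasure N] fun t => b t * (u t * u₀ t) := by
    filter_upwards [ae_radialMeasure_mem N] with t ht
    exact mul_nonneg (le_max_right _ _) (hq0 t (Ioo_subset_Icc_self ht))
  filter_upwards [(integral_eq_zero_iff_of_nonneg_ae hae hi).1 hInt, hne, hab,
    ae_radialMeasure_mem N] with t ht h1 h2 h3
  have h3' := Ioo_subset_Icc_self h3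
  rcases mul_eq_zero.1 ht with h4 | h4
  · linarith
  · exact absurd (hz t h3' h4 (hW0 t h3')) h1

lemma RadialSystem.finite_zeros (h₀ : RadialSystem N (fun _ => μ) u₀ v₀)
    (hnd : ∀ r ∈ Icc (0:ℝ) 1, u₀ r ≠ 0 ∨ v₀ r ≠ 0) : {r ∈ Ioo (0:ℝ) 1 | u₀ r = 0}.Finite := by
  by_contra hinf
  obtain ⟨x, hx, hacc⟩ := Set.Infinite.exists_accPt_of_subset_isCompact hinf isCompact_Icc
    (fun r hr => Ioo_subset_Icc_self hr.1 : {r ∈ Ioo (0:ℝ) 1 | u₀ r = 0} ⊆ Icc 0 1)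
  have hacc' := accPt_iff_frequently.1 hacc
  have hfreq : ∃ᶠ y in 𝓝[Icc 0 1] x, u₀ y = 0 := by
    rw [frequently_nhdsWithin_iff]
    exact hacc'.mono fun y hy => ⟨hy.2.2, Ioo_subset_Icc_self hy.2.1⟩
  have hux : u₀ x = 0 := by
    by_contra hne
    exact hfreq ((h₀.cont x hx).eventually_ne hne)
  have hvx : v₀ x ≠ 0 := (hnd x hx).resolve_left (not_not.2 hux)
  have hx0 : x ≠ 0 := fun h => hvx (h ▸ h₀.flux_zero)
  have hx1 : x ≠ 1 := fun h => hvx (h ▸ h₀.neumann)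
  have hxm : x ∈ Ioo (0:ℝ) 1 := ⟨hx.1.lt_of_ne' hx0, hx.2.lt_of_ne hx1⟩
  have hd := (h₀.hasDerivAt (integrable_const μ) hxm).eventually_ne (c := 0)
    (div_ne_zero hvx (pow_ne_zero _ hx0))
  rw [eventually_nhdsWithin_iff] at hd
  exact hacc' (hd.mono fun y hy hc => hy hc.1 hc.2.2)

lemma wronskian_lower_bound {x y z w c : ℝ} (hc : 0 < c) (h : x * y ≤ 0) (h1 : c ≤ |y| + |w|)
    (h2 : |x - y| ≤ c / 4) (h3 : |z - w| ≤ c / 4) :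
    |x * y| ≤ 1 / 2 * |z * y - x * w| ∧ c / 2 * |y| ≤ |z * y - x * w| := by
  have hxy : |x| + |y| ≤ c / 4 := by
    rcases mul_nonpos_iff.1 h with ⟨hx, hy⟩ | ⟨hx, hy⟩
    · rw [abs_of_nonneg hx, abs_of_nonpos hy]; linarith [le_abs_self (x - y)]
    · rw [abs_of_nonpos hx, abs_of_nonneg hy]; linarith [neg_abs_le (x - y)]
  have hx0 := abs_nonneg x
  have hy0 := abs_nonneg y
  have hw : 3 / 4 * c ≤ |w| := by linarith
  have hz : c / 2 ≤ |z| := by linarith [abs_sub_abs_le_abs_sub w z, abs_sub_comm z w]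
  have key : |z * y - x * w| = |z| * |y| + |x| * |w| := by
    obtain ⟨h3l, h3r⟩ := abs_le.1 h3
    rw [← abs_mul, ← abs_mul]
    rcases le_total 0 w with hw0 | hw0
    · have hz0 : 0 ≤ z := by rw [abs_of_nonneg hw0] at hw; linarith
      rcases mul_nonpos_iff.1 h with ⟨hx, hy⟩ | ⟨hx, hy⟩
      · have e1 := mul_nonpos_of_nonneg_of_nonpos hz0 hy
        have e2 := mul_nonneg hx hw0
        rw [abs_of_nonpos e1, abs_of_nonneg e2, abs_of_nonpos (by linarith)]; ring
      · have e1 := mul_nonneg hz0 hy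
        have e2 := mul_nonpos_of_nonpos_of_nonneg hx hw0
        rw [abs_of_nonneg e1, abs_of_nonpos e2, abs_of_nonneg (by linarith)]; ring
    · have hz0 : z ≤ 0 := by rw [abs_of_nonpos hw0] at hw; linarith
      rcases mul_nonpos_iff.1 h with ⟨hx, hy⟩ | ⟨hx, hy⟩
      · have e1 := mul_nonneg_of_nonpos_of_nonpos hz0 hy
        have e2 := mul_nonpos_of_nonneg_of_nonpos hx hw0
        rw [abs_of_nonneg e1, abs_of_nonpos e2, abs_of_nonneg (by linarith)]; ring
      · have e1 := mul_nonpos_of_nonpos_of_nonneg hz0 hy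
        have e2 := mul_nonneg_of_nonpos_of_nonpos hx hw0
        rw [abs_of_nonpos e1, abs_of_nonneg e2, abs_of_nonpos (by linarith)]; ring
  have m1 := mul_le_mul_of_nonneg_right hz hy0
  have m2 := mul_le_mul_of_nonneg_left hw hx0
  have m3 : |x| * |y| ≤ |x| * (c / 4) := mul_le_mul_of_nonneg_left (by linarith) hx0
  have m4 := mul_nonneg hc.le hx0
  have m5 := mul_nonneg hc.le hy0
  rw [key, abs_mul]
  constructor <;> nlinarith

/-- A solution for `a ≥ μ` which is close to a nondegenerate solution for `μ` forces `a = μ`. -/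
lemma RadialSystem.ae_eq_of_close (h : RadialSystem N a u v)
    (h₀ : RadialSystem N (fun _ => μ) u₀ v₀) (ha : Integrable a (radialMeasure N))
    (haμ : ∀ᵐ r ∂(radialMeasure N), μ ≤ a r) {c : ℝ} (hc : 0 < c)
    (hcl : ∀ r ∈ Icc (0:ℝ) 1, c ≤ |u₀ r| + |v₀ r|)
    (hu : ∀ r ∈ Icc (0:ℝ) 1, |u r - u₀ r| ≤ c / 4)
    (hv : ∀ r ∈ Icc (0:ℝ) 1, |v r - v₀ r| ≤ c / 4) :
    ∀ᵐ r ∂(radialMeasure N), a r = μ := by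
  have key : ∀ r ∈ Icc (0:ℝ) 1, u r * u₀ r ≤ 0 →
      |u r * u₀ r| ≤ 1 / 2 * |v r * u₀ r - u r * v₀ r| ∧
      c / 2 * |u₀ r| ≤ |v r * u₀ r - u r * v₀ r| := by
    intro r hr hle
    exact wronskian_lower_bound hc hle (hcl r hr) (hu r hr) (hv r hr)
  have hne : ∀ᵐ r ∂(radialMeasure N), u₀ r ≠ 0 := by
    have hfin := h₀.finite_zeros (fun r hr => by
      by_contra! hcon
      have := hcl r hr
      simp [hcon.1, hcon.2] at this
      linarith)
    have h0 : ∀ᵐ r ∂(radialMeasure N), r ∉ {r ∈ Ioo (0:ℝ) 1 | u₀ r = 0} :=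
      (ae_radialMeasure_iff N _).2 (ae_restrict_of_ae (hfin.countable.ae_notMem volume))
    filter_upwards [h0, ae_radialMeasure_mem N] with r h1 h2 h3
    exact h1 ⟨h2, h3⟩
  refine h.ae_eq_of_wronskian_bound h₀ ha haμ (by norm_num) (fun r hr hle => (key r hr hle).1)
    (fun r hr h1 h2 => ?_) hne
  have h3 := (key r hr h1.le).2
  rw [h2, abs_zero] at h3
  have : |u₀ r| ≤ 0 := by
    by_contra! hpos
    have := mul_pos (half_pos hc) hpos
    linarith
  exact abs_eq_zero.1 (le_antisymm this (abs_nonneg _))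

end

section WeakCompactness

open scoped ENNReal

variable {α : Type*} [MeasurableSpace α] {ν : Measure α} {κ : ℝ}

/-- Weak sequential compactness, along an ultrafilter, of densities with uniformly small mass on
small sets. -/
lemma exists_density_tendsto_ultrafilter [IsFiniteMeasure ν] {b : ℕ → α → ℝ≥0∞} {C : ℝ≥0∞}
    (hC : C ≠ ∞) (hκ : 0 < κ)
    (hb : ∀ n E, MeasurableSet E → ∫⁻ x in E, b n x ∂ν ≤ C * (ν E) ^ κ) (U : Ultrafilter ℕ) :
    ∃ b₀ : α → ℝ≥0∞, Measurable b₀ ∧ ∫⁻ x, b₀ x ∂ν ≠ ∞ ∧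
      ∀ E, MeasurableSet E →
        Tendsto (fun n => ∫⁻ x in E, b n x ∂ν) U (𝓝 (∫⁻ x in E, b₀ x ∂ν)) := by
  set m : Set α → ℝ≥0∞ := fun E => (U.map fun n => ∫⁻ x in E, b n x ∂ν).lim with hm
  have hlim : ∀ E, Tendsto (fun n => ∫⁻ x in E, b n x ∂ν) U (𝓝 (m E)) := fun E =>
    (U.map fun n => ∫⁻ x in E, b n x ∂ν).le_nhds_lim
  have hle : ∀ E, MeasurableSet E → m E ≤ C * (ν E) ^ κ := fun E hE =>
    le_of_tendsto (hlim E) (Eventually.of_forall fun n => hb n E hE)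
  have hadd : ∀ E F, MeasurableSet F → Disjoint E F → m (E ∪ F) = m E + m F := by
    intro E F hF hd
    refine tendsto_nhds_unique (hlim _) (((hlim E).add (hlim F)).congr fun n => ?_)
    rw [lintegral_union hF hd]
  have hzero : ∀ E, MeasurableSet E → ν E = 0 → m E = 0 := by
    intro E hE h0
    have := hle E hE
    rwa [h0, ENNReal.zero_rpow_of_pos hκ, mul_zero, nonpos_iff_eq_zero] at this
  have hempty : m ∅ = 0 := hzero ∅ MeasurableSet.empty measure_empty
  have hsum : ∀ ⦃f : ℕ → Set α⦄, (∀ i, MeasurableSet (f i)) → Pairwise (Function.onFun Disjoint f) →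
      m (⋃ i, f i) = ∑' i, m (f i) := by
    intro f hf hd
    set t : ℕ → Set α := fun n => ⋃ i ∈ Ici n, f i with ht
    have htm : ∀ n, MeasurableSet (t n) := fun n =>
      MeasurableSet.biUnion (to_countable _) fun i _ => hf i
    have hstep : ∀ n, m (t n) = m (f n) + m (t (n + 1)) := by
      intro n
      rw [← hadd _ _ (htm _)]
      · congr 1
        ext x
        simp only [ht, mem_iUnion, mem_Ici, mem_union, exists_prop]
        constructor
        · rintro ⟨i, hi, hx⟩
          rcases hi.eq_or_lt with rfl | hi
          · exact Or.inl hx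
          · exact Or.inr ⟨i, hi, hx⟩
        · rintro (hx | ⟨i, hi, hx⟩)
          · exact ⟨n, le_rfl, hx⟩
          · exact ⟨i, by omega, hx⟩
      · simp only [ht, disjoint_iUnion_right, mem_Ici]
        exact fun i hi => hd (by omega)
    have h0 : t 0 = ⋃ i, f i := by simp [ht]
    have hpart : ∀ n, m (⋃ i, f i) = ∑ i ∈ Finset.range n, m (f i) + m (t n) := by
      intro n
      induction n with
      | zero => simp [h0]
      | succ n ih => rw [ih, hstep n, Finset.sum_range_succ, add_assoc]
    have hνt : Tendsto (fun n => ν (t n)) atTop (𝓝 0) := by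
      exact tendsto_measure_biUnion_Ici_zero_of_pairwise_disjoint
        (fun i => (hf i).nullMeasurableSet) hd
    have hmt : Tendsto (fun n => m (t n)) atTop (𝓝 0) := by
      refine tendsto_of_tendsto_of_tendsto_of_le_of_le tendsto_const_nhds ?_
        (fun n => zero_le) (fun n => hle _ (htm n))
      have := ENNReal.Tendsto.const_mul (a := C)
        ((ENNReal.continuous_rpow_const (y := κ)).tendsto 0 |>.comp hνt) (Or.inr hC)
      simpa [ENNReal.zero_rpow_of_pos hκ] using this
    have h1 : Tendsto (fun n => ∑ i ∈ Finset.range n, m (f i) + m (t n)) atTop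
        (𝓝 (∑' i, m (f i) + 0)) := (ENNReal.tendsto_nat_tsum _).add hmt
    rw [add_zero] at h1
    exact tendsto_nhds_unique (tendsto_const_nhds.congr hpart) h1
  let M : Measure α := Measure.ofMeasurable (fun E _ => m E) hempty (fun f hf hd => hsum hf hd)
  have hM : ∀ E, MeasurableSet E → M E = m E := fun E hE => Measure.ofMeasurable_apply E hE
  have hfin : IsFiniteMeasure M := ⟨by
    rw [hM _ MeasurableSet.univ]
    refine (hle _ MeasurableSet.univ).trans_lt (ENNReal.mul_lt_top hC.lt_top ?_)
    exact ENNReal.rpow_lt_top_of_nonneg hκ.le (measure_ne_top _ _)⟩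
  have hac : M ≪ ν := Measure.AbsolutelyContinuous.mk fun E hE h0 => by
    rw [hM E hE, hzero E hE h0]
  refine ⟨M.rnDeriv ν, Measure.measurable_rnDeriv _ _, (Measure.lintegral_rnDeriv_lt_top _ _).ne,
    fun E hE => ?_⟩
  rw [Measure.setLIntegral_rnDeriv hac, hM E hE]
  exact hlim E

lemma tendsto_integral_mul_of_tendsto_setIntegral {b : ℕ → α → ℝ} {b₀ : α → ℝ} {B : ℝ}
    (hb : ∀ n, Integrable (b n) ν) (hb₀ : Integrable b₀ ν)
    (hB : ∀ n, ∫ x, |b n x| ∂ν ≤ B) {l : Filter ℕ}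
    (hE : ∀ E, MeasurableSet E →
      Tendsto (fun n => ∫ x in E, b n x ∂ν) l (𝓝 (∫ x in E, b₀ x ∂ν)))
    {f : α → ℝ} (hf : Measurable f) {K : ℝ} (hK : ∀ x, |f x| ≤ K) :
    Tendsto (fun n => ∫ x, f x * b n x ∂ν) l (𝓝 (∫ x, f x * b₀ x ∂ν)) := by
  have hfloor : ∀ δ : ℝ, 0 < δ → ∃ J : ℕ, ∀ x, ⌊f x / δ⌋ ∈ Finset.Icc (-(J:ℤ)) J := by
    intro δ hδ
    obtain ⟨J, hJ⟩ := exists_nat_ge (K / δ)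
    refine ⟨J, fun x => Finset.mem_Icc.2 ⟨?_, ?_⟩⟩
    · rw [Int.le_floor]
      push_cast
      have : -K / δ ≤ f x / δ := div_le_div_of_nonneg_right (neg_le_of_abs_le (hK x)) hδ.le
      rw [neg_div] at this
      linarith
    · have : f x / δ ≤ K / δ := div_le_div_of_nonneg_right (le_of_abs_le (hK x)) hδ.le
      have h2 : (⌊f x / δ⌋ : ℝ) ≤ J := (Int.floor_le _).trans (this.trans hJ)
      exact_mod_cast h2
  have hfm : ∀ δ : ℝ, Measurable fun x => ⌊f x / δ⌋ := fun δ =>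
    Int.measurable_floor.comp (hf.div_const δ)
  have hset : ∀ δ : ℝ, ∀ j : ℤ, MeasurableSet {x | ⌊f x / δ⌋ = j} := fun δ j =>
    hfm δ (measurableSet_singleton j)
  have hInt : ∀ (g : α → ℝ), Integrable g ν → ∀ δ : ℝ, ∀ J : ℕ,
      (∀ x, ⌊f x / δ⌋ ∈ Finset.Icc (-(J:ℤ)) J) →
      Integrable (fun x => δ * ⌊f x / δ⌋ * g x) ν ∧ ∫ x, δ * ⌊f x / δ⌋ * g x ∂ν =
        ∑ j ∈ Finset.Icc (-(J:ℤ)) J, δ * j * ∫ x in {x | ⌊f x / δ⌋ = j}, g x ∂ν := by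
    intro g hg δ J hJ
    have e : (fun x => δ * ⌊f x / δ⌋ * g x) = fun x => ∑ j ∈ Finset.Icc (-(J:ℤ)) J,
        δ * j * indicator {x | ⌊f x / δ⌋ = j} g x := by
      ext x
      rw [Finset.sum_eq_single_of_mem _ (hJ x)]
      · simp
      · intro j _ hj
        rw [indicator_of_notMem (by simpa using hj.symm), mul_zero]
    have hi : ∀ j ∈ Finset.Icc (-(J:ℤ)) J,
        Integrable (fun x => δ * j * indicator {x | ⌊f x / δ⌋ = j} g x) ν := fun j _ =>
      (hg.indicator (hset δ j)).const_mul _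
    rw [e]
    refine ⟨integrable_finsetSum _ hi, ?_⟩
    rw [integral_finsetSum _ hi]
    refine Finset.sum_congr rfl fun j _ => ?_
    rw [integral_const_mul, integral_indicator (hset δ j)]
  have hdiff : ∀ (g : α → ℝ), Integrable g ν → ∀ δ : ℝ, 0 < δ →
      |∫ x, f x * g x ∂ν - ∫ x, δ * ⌊f x / δ⌋ * g x ∂ν| ≤ δ * ∫ x, |g x| ∂ν := by
    intro g hg δ hδ
    obtain ⟨J, hJ⟩ := hfloor δ hδ
    have hfg : Integrable (fun x => f x * g x) ν :=
      hg.bdd_mul hf.aestronglyMeasurable (Eventually.of_forall hK)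
    rw [← integral_sub hfg (hInt g hg δ J hJ).1, ← integral_const_mul]
    refine (abs_integral_le_integral_abs).trans (integral_mono_ae ?_ (hg.abs.const_mul _) ?_)
    · exact (hfg.sub (hInt g hg δ J hJ).1).abs
    · refine Eventually.of_forall fun x => ?_
      show |f x * g x - δ * ⌊f x / δ⌋ * g x| ≤ δ * |g x|
      rw [← sub_mul, abs_mul]
      refine mul_le_mul_of_nonneg_right ?_ (abs_nonneg _)
      have h1 := Int.floor_le (f x / δ)
      have h2 := Int.lt_floor_add_one (f x / δ)
      rw [le_div_iff₀ hδ] at h1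
      rw [div_lt_iff₀ hδ] at h2
      rw [abs_le]
      constructor <;> linarith
  rw [Metric.tendsto_nhds]
  intro ε hε
  set B' := max (max B (∫ x, |b₀ x| ∂ν)) 1 with hB'
  have hB'pos : 0 < B' := lt_max_of_lt_right one_pos
  set δ := ε / (4 * B') with hδdef
  have hδ : 0 < δ := by positivity
  have hδB : δ * B' = ε / 4 := by rw [hδdef]; field_simp
  obtain ⟨J, hJ⟩ := hfloor δ hδ
  have hlim : Tendsto (fun n => ∫ x, δ * ⌊f x / δ⌋ * b n x ∂ν) l
      (𝓝 (∫ x, δ * ⌊f x / δ⌋ * b₀ x ∂ν)) := by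
    rw [(hInt b₀ hb₀ δ J hJ).2]
    simp_rw [fun n => (hInt (b n) (hb n) δ J hJ).2]
    exact tendsto_finsetSum _ fun j _ => (hE _ (hset δ j)).const_mul _
  filter_upwards [Metric.tendsto_nhds.1 hlim (ε / 4) (by positivity)] with n hn
  rw [Real.dist_eq] at hn ⊢
  have h1 := hdiff (b n) (hb n) δ hδ
  have h2 := hdiff b₀ hb₀ δ hδ
  have h3 : δ * ∫ x, |b n x| ∂ν ≤ ε / 4 := by
    rw [← hδB]
    exact mul_le_mul_of_nonneg_left ((hB n).trans ((le_max_left _ _).trans (le_max_left _ _))) hδ.le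
  have h4 : δ * ∫ x, |b₀ x| ∂ν ≤ ε / 4 := by
    rw [← hδB]
    exact mul_le_mul_of_nonneg_left ((le_max_right _ _).trans (le_max_left _ _)) hδ.le
  rw [abs_lt] at hn ⊢
  rw [abs_le] at h1 h2
  constructor <;> linarith [h1.1, h1.2, h2.1, h2.2, hn.1, hn.2]

/-- Real-valued version of `exists_density_tendsto_ultrafilter`, tested against bounded
measurable functions. -/
lemma exists_weakLimit [IsFiniteMeasure ν] {b : ℕ → α → ℝ} {A : ℝ} (hκ : 0 < κ)
    (hbi : ∀ n, Integrable (b n) ν) (hb0 : ∀ n, 0 ≤ᵐ[ν] b n)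
    (hb : ∀ n E, MeasurableSet E → ∫ x in E, b n x ∂ν ≤ A * (ν.real E) ^ κ) (U : Ultrafilter ℕ) :
    ∃ b₀ : α → ℝ, Measurable b₀ ∧ (∀ x, 0 ≤ b₀ x) ∧ Integrable b₀ ν ∧
      ∀ f : α → ℝ, Measurable f → (∃ K, ∀ x, |f x| ≤ K) →
        Tendsto (fun n => ∫ x, f x * b n x ∂ν) U (𝓝 (∫ x, f x * b₀ x ∂ν)) := by
  have hconv : ∀ n E, ENNReal.ofReal (∫ x in E, b n x ∂ν) =
      ∫⁻ x in E, ENNReal.ofReal (b n x) ∂ν := fun n E =>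
    ofReal_integral_eq_lintegral_ofReal (hbi n).integrableOn (ae_restrict_of_ae (hb0 n))
  obtain ⟨d, hdm, hdfin, hd⟩ := exists_density_tendsto_ultrafilter (ν := ν)
    (b := fun n x => ENNReal.ofReal (b n x)) (C := ENNReal.ofReal A) ENNReal.ofReal_ne_top hκ
    (fun n E hE => by
      rw [← hconv]
      refine (ENNReal.ofReal_le_ofReal (hb n E hE)).trans ?_
      rw [ENNReal.ofReal_mul' (by positivity), ← ENNReal.ofReal_rpow_of_nonneg measureReal_nonneg
        hκ.le, ofReal_measureReal]) U
  have hdi : Integrable (fun x => (d x).toReal) ν :=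
    integrable_toReal_of_lintegral_ne_top hdm.aemeasurable hdfin
  have hdlt : ∀ᵐ x ∂ν, d x < ∞ := ae_lt_top hdm hdfin
  have hE : ∀ E, MeasurableSet E →
      Tendsto (fun n => ∫ x in E, b n x ∂ν) U (𝓝 (∫ x in E, (d x).toReal ∂ν)) := by
    intro E hE
    have hne : ∫⁻ x in E, d x ∂ν ≠ ∞ :=
      ((setLIntegral_le_lintegral _ _).trans_lt hdfin.lt_top).ne
    have h1 := (ENNReal.tendsto_toReal hne).comp (hd E hE)
    rw [integral_toReal hdm.aemeasurable (ae_restrict_of_ae hdlt)]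
    refine h1.congr fun n => ?_
    simp only [Function.comp]
    rw [← hconv, ENNReal.toReal_ofReal (integral_nonneg_of_ae (ae_restrict_of_ae (hb0 n)))]
  refine ⟨fun x => (d x).toReal, hdm.ennreal_toReal, fun x => ENNReal.toReal_nonneg, hdi,
    fun f hf ⟨K, hK⟩ => ?_⟩
  refine tendsto_integral_mul_of_tendsto_setIntegral (B := A * (ν.real univ) ^ κ) hbi hdi
    (fun n => ?_) hE hf hK
  have := hb n univ MeasurableSet.univ
  rw [Measure.restrict_univ] at this
  refine le_trans (le_of_eq (integral_congr_ae ?_)) this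
  filter_upwards [hb0 n] with x hx
  exact abs_of_nonneg hx

end WeakCompactness

section Compactness

/-- Arzelà–Ascoli along an ultrafilter: uniformly equicontinuous bounded functions on `[0,1]`
converge uniformly. -/
lemma exists_uniformLimit_ultrafilter {w : ℕ → ℝ → ℝ} {C : ℝ}
    (hC : ∀ n, ∀ r ∈ Icc (0:ℝ) 1, |w n r| ≤ C)
    (heq : ∀ ε > 0, ∃ δ > 0, ∀ r ∈ Icc (0:ℝ) 1, ∀ s ∈ Icc (0:ℝ) 1, |r - s| < δ →
      ∀ n, |w n r - w n s| ≤ ε) (U : Ultrafilter ℕ) :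
    ∃ W : ℝ → ℝ, Continuous W ∧ (∀ r, |W r| ≤ C) ∧
      ∀ ε > 0, ∀ᶠ n in (U : Filter ℕ), ∀ r ∈ Icc (0:ℝ) 1, |w n r - W r| ≤ ε := by
  set p : ℝ → ℝ := fun t => max 0 (min t 1) with hp
  have hpI : ∀ t, p t ∈ Icc (0:ℝ) 1 := fun t =>
    ⟨le_max_left _ _, max_le zero_le_one (min_le_right _ _)⟩
  have hpid : ∀ t ∈ Icc (0:ℝ) 1, p t = t := fun t ht => by simp [hp, ht.1, ht.2]
  have hlim : ∀ t, ∃ y, Tendsto (fun n => w n (p t)) U (𝓝 y) := by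
    intro t
    have hmem : (U.map fun n => w n (p t) : Filter ℝ) ≤ 𝓟 (Icc (-C) C) := by
      rw [le_principal_iff]
      have : ∀ᶠ n in (U : Filter ℕ), w n (p t) ∈ Icc (-C) C :=
        Eventually.of_forall fun n => abs_le.1 (hC n _ (hpI t))
      exact this
    obtain ⟨y, -, hy⟩ := isCompact_Icc.ultrafilter_le_nhds _ hmem
    exact ⟨y, hy⟩
  choose W hW using hlim
  have hWsub : ∀ ε > 0, ∃ δ > 0, ∀ r s, |p r - p s| < δ → |W r - W s| ≤ ε := by
    intro ε hε
    obtain ⟨δ, hδ, h⟩ := heq ε hε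
    exact ⟨δ, hδ, fun r s hrs => le_of_tendsto ((hW r).sub (hW s)).abs
      (Eventually.of_forall fun n => h _ (hpI r) _ (hpI s) hrs n)⟩
  refine ⟨W, ?_, fun r => le_of_tendsto (hW r).abs (Eventually.of_forall fun n => hC n _ (hpI r)),
    ?_⟩
  · rw [Metric.continuous_iff]
    intro r ε hε
    obtain ⟨δ, hδ, h⟩ := hWsub (ε / 2) (half_pos hε)
    have hpc : Continuous p := by fun_prop
    obtain ⟨η, hη, h2⟩ := Metric.continuous_iff.1 hpc r δ hδ
    refine ⟨η, hη, fun s hs => ?_⟩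
    have := h s r (h2 s hs)
    rw [Real.dist_eq]
    linarith
  · intro ε hε
    obtain ⟨δ₁, hδ₁, h₁⟩ := heq (ε / 3) (by positivity)
    obtain ⟨δ₂, hδ₂, h₂⟩ := hWsub (ε / 3) (by positivity)
    obtain ⟨t, htI, htf, htc⟩ := isCompact_Icc.finite_cover_balls (X := ℝ)
      (s := Icc (0:ℝ) 1) (lt_min hδ₁ hδ₂)
    have hev : ∀ᶠ n in (U : Filter ℕ), ∀ x ∈ t, |w n x - W x| < ε / 3 := by
      rw [eventually_all_finite htf]
      intro x hx
      have := Metric.tendsto_nhds.1 (hW x) (ε / 3) (by positivity)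
      rwa [hpid x (htI hx)] at this
    filter_upwards [hev] with n hn r hr
    obtain ⟨x, hx, hrx⟩ := mem_iUnion₂.1 (htc hr)
    rw [Metric.mem_ball, Real.dist_eq, lt_min_iff] at hrx
    have e1 := h₁ r hr x (htI hx) hrx.1 n
    have e2 := h₂ r x (by rw [hpid r hr, hpid x (htI hx)]; exact hrx.2)
    have e3 := hn x hx
    rw [abs_le] at e1 e2 ⊢
    rw [abs_lt] at e3
    constructor <;> linarith [e1.1, e1.2, e2.1, e2.2, e3.1, e3.2]

variable {N : ℕ} {μ κ A : ℝ} {a u v : ℝ → ℝ}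

lemma RadialSystem.abs_flux_sub_le (h : RadialSystem N a u v)
    (ha : Integrable a (radialMeasure N)) (hA : 0 ≤ A) (hκ : 0 < κ)
    (haE : ∀ E, MeasurableSet E →
      ∫ x in E, |a x| ∂(radialMeasure N) ≤ A * ((radialMeasure N).real E) ^ κ)
    (hu : ∀ r ∈ Icc (0:ℝ) 1, |u r| ≤ 1) {s r : ℝ} (hs : 0 ≤ s) (hsr : s ≤ r) (hr : r ≤ 1) :
    |v r - v s| ≤ A * (r ^ (N - 1) * (r - s)) ^ κ := by
  rw [h.flux_sub ha hs hsr hr, abs_neg]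
  refine abs_integral_le_integral_abs.trans (le_trans ?_ ((haE _ measurableSet_Ioc).trans
    (mul_le_mul_of_nonneg_left (Real.rpow_le_rpow measureReal_nonneg
      (radialMeasure_real_Ioc_le N hs hsr) hκ.le) hA)))
  refine setIntegral_mono_on (h.integrable_mul ha).abs.integrableOn ha.abs.integrableOn
    measurableSet_Ioc fun t ht => ?_
  rw [abs_mul]
  exact mul_le_of_le_one_right (abs_nonneg _) (hu t ⟨hs.trans ht.1.le, ht.2.trans hr⟩)

lemma RadialSystem.abs_sub_le (h : RadialSystem N a u v) (hN : 2 ≤ N)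
    (ha : Integrable a (radialMeasure N)) (hA : 0 ≤ A) (hκ : 0 < κ) (hβ : 0 < N * κ - N + 2)
    (haE : ∀ E, MeasurableSet E →
      ∫ x in E, |a x| ∂(radialMeasure N) ≤ A * ((radialMeasure N).real E) ^ κ)
    (hu : ∀ r ∈ Icc (0:ℝ) 1, |u r| ≤ 1) {s r : ℝ} (hs : 0 ≤ s) (hsr : s ≤ r) (hr : r ≤ 1) :
    |u r - u s| ≤ A / (N * κ - N + 2) *
      (r ^ (N * κ - N + 2 : ℝ) - s ^ (N * κ - N + 2 : ℝ)) := by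
  have hcast : ((N - 1 : ℕ) : ℝ) = N - 1 := by rw [Nat.cast_sub (by omega)]; simp
  have hflux : ∀ t, 0 < t → t ≤ 1 → |v t / t ^ (N - 1)| ≤ A * t ^ (N * κ - N + 1 : ℝ) := by
    intro t ht ht1
    have h1 := h.abs_flux_sub_le ha hA hκ haE hu le_rfl ht.le ht1
    rw [h.flux_zero, sub_zero, sub_zero, ← pow_succ, Nat.sub_add_cancel (by omega)] at h1
    rw [abs_div, abs_of_pos (pow_pos ht _), div_le_iff₀ (pow_pos ht _)]
    refine h1.trans (le_of_eq ?_)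
    rw [mul_assoc, ← Real.rpow_natCast t (N - 1), ← Real.rpow_add ht, ← Real.rpow_natCast t N,
      ← Real.rpow_mul ht.le, hcast]
    congr 2
    ring
  have hpos : ∀ s, 0 < s → s ≤ r → |u r - u s| ≤ A / (N * κ - N + 2) *
      (r ^ (N * κ - N + 2 : ℝ) - s ^ (N * κ - N + 2 : ℝ)) := by
    intro s hs hsr
    rw [h.sub_eq s r hs hsr hr]
    have hi : IntervalIntegrable (fun t : ℝ => A * t ^ (N * κ - N + 1 : ℝ)) volume s r :=
      (intervalIntegral.intervalIntegrable_rpow' (by linarith)).const_mul _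
    have hle := intervalIntegral.norm_integral_le_of_norm_le hsr
      (f := fun t => v t / t ^ (N - 1)) (g := fun t : ℝ => A * t ^ (N * κ - N + 1 : ℝ))
      (μ := volume)
      (Eventually.of_forall fun t ht => hflux t (hs.trans ht.1) (ht.2.trans hr)) hi
    refine hle.trans (le_of_eq ?_)
    rw [intervalIntegral.integral_const_mul, integral_rpow (Or.inl (by linarith)),
      show (N * κ - N + 1 + 1 : ℝ) = N * κ - N + 2 by ring]
    ring
  rcases hs.eq_or_lt with rfl | hs
  · rcases hsr.eq_or_lt with rfl | hr0
    · simp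
    have hmem : Icc (0:ℝ) 1 ∈ 𝓝[>] (0:ℝ) :=
      mem_of_superset (Ioo_mem_nhdsGT one_pos) Ioo_subset_Icc_self
    have hcu : Tendsto u (𝓝[>] 0) (𝓝 (u 0)) :=
      (h.cont 0 (by simp)).mono_left (nhdsWithin_le_of_mem hmem)
    have hcr : Tendsto (fun s : ℝ => s ^ (N * κ - N + 2 : ℝ)) (𝓝[>] 0)
        (𝓝 ((0:ℝ) ^ (N * κ - N + 2 : ℝ))) :=
      (Real.continuousAt_rpow_const 0 _ (Or.inr hβ.le)).tendsto.mono_left nhdsWithin_le_nhds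
    refine le_of_tendsto_of_tendsto (tendsto_const_nhds.sub hcu).abs
      ((tendsto_const_nhds.sub hcr).const_mul _) ?_
    filter_upwards [Ioo_mem_nhdsGT hr0] with t ht
    exact hpos t ht.1 ht.2.le
  · exact hpos s hs hsr

lemma RadialSystem.of_tendsto {b : ℕ → ℝ → ℝ} {b₀ u₀ v₀ : ℝ → ℝ} {u v : ℕ → ℝ → ℝ}
    {l : Filter ℕ} [l.NeBot]
    (h : ∀ n, RadialSystem N (fun r => μ + b n r) (u n) (v n))
    (hb : ∀ n, Integrable (b n) (radialMeasure N)) (hb₀ : Integrable b₀ (radialMeasure N))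
    {B : ℝ} (hB : ∀ n, ∫ x, |μ + b n x| ∂(radialMeasure N) ≤ B)
    (hu₀ : Continuous u₀) (hv₀ : Continuous v₀) {C : ℝ} (hu₀C : ∀ r, |u₀ r| ≤ C)
    (hu : ∀ ε > 0, ∀ᶠ n in l, ∀ r ∈ Icc (0:ℝ) 1, |u n r - u₀ r| ≤ ε)
    (hv : ∀ ε > 0, ∀ᶠ n in l, ∀ r ∈ Icc (0:ℝ) 1, |v n r - v₀ r| ≤ ε)
    (hw : ∀ f : ℝ → ℝ, Measurable f → (∃ K, ∀ x, |f x| ≤ K) →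
      Tendsto (fun n => ∫ x, f x * b n x ∂(radialMeasure N)) l
        (𝓝 (∫ x, f x * b₀ x ∂(radialMeasure N)))) :
    RadialSystem N (fun r => μ + b₀ r) u₀ v₀ := by
  have hpu : ∀ r ∈ Icc (0:ℝ) 1, Tendsto (fun n => u n r) l (𝓝 (u₀ r)) := by
    intro r hr
    rw [Metric.tendsto_nhds]
    intro ε hε
    filter_upwards [hu (ε / 2) (half_pos hε)] with n hn
    rw [Real.dist_eq]
    linarith [hn r hr]
  have hpv : ∀ r ∈ Icc (0:ℝ) 1, Tendsto (fun n => v n r) l (𝓝 (v₀ r)) := by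
    intro r hr
    rw [Metric.tendsto_nhds]
    intro ε hε
    filter_upwards [hv (ε / 2) (half_pos hε)] with n hn
    rw [Real.dist_eq]
    linarith [hn r hr]
  have hB0 : 0 ≤ B := (integral_nonneg fun x => abs_nonneg _).trans (hB 0)
  have hai : ∀ n, Integrable (fun r => μ + b n r) (radialMeasure N) := fun n =>
    (integrable_const μ).add (hb n)
  refine ⟨hu₀.continuousOn, fun r hr => ?_, fun s r hs hsr hr => ?_, ?_⟩
  · refine tendsto_nhds_unique (hpv r hr) ?_
    set f : ℝ → ℝ := indicator (Ioc 0 r) u₀ with hf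
    have hfm : Measurable f := hu₀.measurable.indicator measurableSet_Ioc
    have hfC : ∀ x, |f x| ≤ C := by
      intro x
      by_cases hx : x ∈ Ioc 0 r
      · simpa [hf, hx] using hu₀C x
      · simpa [hf, hx] using (abs_nonneg _).trans (hu₀C x)
    have hset : ∀ g : ℝ → ℝ, Integrable g (radialMeasure N) →
        ∫ t in Ioc 0 r, (μ + g t) * u₀ t ∂(radialMeasure N) =
        μ * ∫ t, f t ∂(radialMeasure N) + ∫ t, f t * g t ∂(radialMeasure N) := by
      intro g hg
      rw [← integral_const_mul, ← integral_add, ← integral_indicator measurableSet_Ioc]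
      · congr 1; ext t
        by_cases ht : t ∈ Ioc 0 r
        · simp [hf, ht]; ring
        · simp [hf, ht]
      · refine Integrable.const_mul ?_ _
        exact Integrable.of_bound hfm.aestronglyMeasurable C (Eventually.of_forall hfC)
      · exact hg.bdd_mul hfm.aestronglyMeasurable (Eventually.of_forall hfC)
    have hmain : Tendsto (fun n => - ∫ t in Ioc 0 r, (μ + b n t) * u₀ t ∂(radialMeasure N)) l
        (𝓝 (- ∫ t in Ioc 0 r, (μ + b₀ t) * u₀ t ∂(radialMeasure N))) := by
      rw [hset b₀ hb₀]
      simp_rw [fun n => hset (b n) (hb n)]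
      exact (tendsto_const_nhds.add (hw f hfm ⟨C, hfC⟩)).neg
    have hdiff : Tendsto (fun n => v n r -
        - ∫ t in Ioc 0 r, (μ + b n t) * u₀ t ∂(radialMeasure N)) l (𝓝 0) := by
      rw [Metric.tendsto_nhds]
      intro ε hε
      filter_upwards [hu (ε / (2 * (B + 1))) (by positivity)] with n hn
      rw [Real.dist_eq, sub_zero, (h n).flux r hr, neg_sub_neg, ← integral_sub
        ((hai n).mul_continuousOn_radialMeasure hu₀.continuousOn).integrableOn
        ((h n).integrable_mul (hai n)).integrableOn]
      have hb1 : ∫ t in Ioc 0 r, |(μ + b n t) * u₀ t - (μ + b n t) * u n t| ∂(radialMeasure N) ≤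
          ∫ t in Ioc 0 r, ε / (2 * (B + 1)) * |μ + b n t| ∂(radialMeasure N) := by
        refine setIntegral_mono_on ?_ ((hai n).abs.const_mul _).integrableOn measurableSet_Ioc
          fun t ht => ?_
        · exact (((hai n).mul_continuousOn_radialMeasure hu₀.continuousOn).sub
            ((h n).integrable_mul (hai n))).abs.integrableOn
        · rw [← mul_sub, abs_mul, mul_comm, abs_sub_comm]
          exact mul_le_mul_of_nonneg_right (hn t ⟨ht.1.le, ht.2.trans hr.2⟩) (abs_nonneg _)
      have hb2 : ∫ t in Ioc 0 r, ε / (2 * (B + 1)) * |μ + b n t| ∂(radialMeasure N) ≤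
          ε / (2 * (B + 1)) * B := by
        rw [integral_const_mul]
        refine mul_le_mul_of_nonneg_left (le_trans ?_ (hB n)) (by positivity)
        exact setIntegral_le_integral (hai n).abs (Eventually.of_forall fun x => abs_nonneg _)
      have hb3 : ε / (2 * (B + 1)) * B < ε := by
        rw [div_mul_eq_mul_div, div_lt_iff₀ (by positivity)]
        nlinarith
      exact (abs_integral_le_integral_abs.trans (hb1.trans hb2)).trans_lt hb3
    have := hdiff.add hmain
    simpa using this
  · have hs1 : s ≤ 1 := hsr.trans hr
    refine tendsto_nhds_unique
      ((hpu r ⟨hs.le.trans hsr, hr⟩).sub (hpu s ⟨hs.le, hs1⟩)) ?_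
    have hi₀ : IntervalIntegrable (fun t => v₀ t / t ^ (N - 1)) volume s r := by
      refine ContinuousOn.intervalIntegrable ?_
      rw [uIcc_of_le hsr]
      exact hv₀.continuousOn.div (by fun_prop) fun t ht => pow_ne_zero _ (hs.trans_le ht.1).ne'
    rw [Metric.tendsto_nhds]
    intro ε hε
    have hsN : 0 < s ^ (N - 1) := pow_pos hs _
    filter_upwards [hv (ε / 2 * s ^ (N - 1)) (by positivity)] with n hn
    rw [Real.dist_eq, (h n).sub_eq s r hs hsr hr,
      ← intervalIntegral.integral_sub ((h n).intervalIntegrable_div (hai n) hs hsr hr) hi₀]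
    have := intervalIntegral.norm_integral_le_of_norm_le_const (a := s) (b := r) (C := ε / 2)
      (f := fun t => v n t / t ^ (N - 1) - v₀ t / t ^ (N - 1)) (fun t ht => by
        rw [uIoc_of_le hsr] at ht
        have ht0 : 0 < t := hs.trans ht.1
        rw [← sub_div, Real.norm_eq_abs, abs_div, abs_of_pos (pow_pos ht0 _),
          div_le_iff₀ (pow_pos ht0 _)]
        refine (hn t ⟨ht0.le, ht.2.trans hr⟩).trans ?_
        exact mul_le_mul_of_nonneg_left (pow_le_pow_left₀ hs.le ht.1.le _) (half_pos hε).le)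
    rw [abs_of_nonneg (sub_nonneg.2 hsr), Real.norm_eq_abs] at this
    nlinarith
  · refine tendsto_nhds_unique (hpv 1 (by simp)) ?_
    simp_rw [fun n => (h n).neumann]
    exact tendsto_const_nhds

/-- A radial solution can be normalised to have sup norm one. -/
lemma RadialSystem.exists_normalized (h : RadialSystem N a u v)
    (hu : ∃ r ∈ Icc (0:ℝ) 1, u r ≠ 0) :
    ∃ u' v', RadialSystem N a u' v' ∧ (∀ r ∈ Icc (0:ℝ) 1, |u' r| ≤ 1) ∧
      ∃ r ∈ Icc (0:ℝ) 1, |u' r| = 1 := by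
  obtain ⟨x, hx, hmax⟩ := isCompact_Icc.exists_isMaxOn (s := Icc (0:ℝ) 1) ⟨0, by simp⟩ h.cont.abs
  obtain ⟨y, hy, hy0⟩ := hu
  have hpos : 0 < |u x| := (abs_pos.2 hy0).trans_le (hmax hy)
  refine ⟨_, _, h.const_mul |u x|⁻¹, fun r hr => ?_, x, hx, ?_⟩
  · rw [abs_mul, abs_inv, abs_abs, inv_mul_le_iff₀ hpos, mul_one]
    exact hmax hr
  · rw [abs_mul, abs_inv, abs_abs, inv_mul_cancel₀ hpos.ne']

/-- Compactness of potentials `μ + b n` admitting radial Neumann solutions. -/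
theorem exists_limit_potential (hN : 2 ≤ N) (hμ : 0 ≤ μ) (hκ : 0 < κ) (hκ1 : κ ≤ 1)
    (hβ : 0 < N * κ - N + 2) (hA : 0 ≤ A) {b : ℕ → ℝ → ℝ}
    (hbi : ∀ n, Integrable (b n) (radialMeasure N)) (hb0 : ∀ n, 0 ≤ᵐ[radialMeasure N] b n)
    (hbne : ∀ n, ¬ b n =ᵐ[radialMeasure N] 0)
    (hbE : ∀ n E, MeasurableSet E →
      ∫ x in E, b n x ∂(radialMeasure N) ≤ A * ((radialMeasure N).real E) ^ κ)
    (hsol : ∀ n, ∃ u, IsRadialNeumannSolution N (fun r => μ + b n r) u ∧ NontrivialSol u)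
    (U : Ultrafilter ℕ) :
    ∃ b₀ : ℝ → ℝ, Measurable b₀ ∧ (∀ x, 0 ≤ b₀ x) ∧ Integrable b₀ (radialMeasure N) ∧
      (¬ b₀ =ᵐ[radialMeasure N] 0) ∧
      (∃ u, IsRadialNeumannSolution N (fun r => μ + b₀ r) u ∧ NontrivialSol u) ∧
      ∀ f : ℝ → ℝ, Measurable f → (∃ K, ∀ x, |f x| ≤ K) →
        Tendsto (fun n => ∫ x, f x * b n x ∂(radialMeasure N)) U
          (𝓝 (∫ x, f x * b₀ x ∂(radialMeasure N))) := by
  obtain ⟨b₀, hb₀m, hb₀0, hb₀i, hw⟩ := exists_weakLimit hκ hbi hb0 hbE U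
  have hai : ∀ n, Integrable (fun r => μ + b n r) (radialMeasure N) := fun n =>
    (integrable_const μ).add (hbi n)
  have haE : ∀ n E, MeasurableSet E → ∫ x in E, |μ + b n x| ∂(radialMeasure N) ≤
      (μ + A) * ((radialMeasure N).real E) ^ κ := by
    intro n E hE
    have h1 : ∫ x in E, |μ + b n x| ∂(radialMeasure N) =
        ∫ x in E, (μ + b n x) ∂(radialMeasure N) := by
      refine integral_congr_ae (ae_restrict_of_ae ?_)
      filter_upwards [hb0 n] with x hx
      exact abs_of_nonneg (add_nonneg hμ hx)
    rw [h1, integral_add (integrable_const μ) (hbi n).integrableOn, setIntegral_const, smul_eq_mul,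
      add_mul]
    refine add_le_add ?_ (hbE n E hE)
    rw [mul_comm]
    refine mul_le_mul_of_nonneg_left ?_ hμ
    rcases (measureReal_nonneg (μ := radialMeasure N) (s := E)).eq_or_lt with h0 | h0
    · rw [← h0, Real.zero_rpow hκ.ne']
    · simpa using Real.rpow_le_rpow_of_exponent_ge h0 (radialMeasure_real_le_one N E) hκ1
  have hA0 : 0 ≤ μ + A := add_nonneg hμ hA
  have hB : ∀ n, ∫ x, |μ + b n x| ∂(radialMeasure N) ≤ μ + A := by
    intro n
    have := haE n univ MeasurableSet.univ
    rw [Measure.restrict_univ] at this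
    exact this.trans (mul_le_of_le_one_right hA0
      (Real.rpow_le_one measureReal_nonneg (radialMeasure_real_le_one N _) hκ.le))
  have hex : ∀ n, ∃ u v, RadialSystem N (fun r => μ + b n r) u v ∧
      (∀ r ∈ Icc (0:ℝ) 1, |u r| ≤ 1) ∧ ∃ r ∈ Icc (0:ℝ) 1, |u r| = 1 := by
    intro n
    obtain ⟨u, hu, hnt⟩ := hsol n
    obtain ⟨v, hv⟩ := hu.exists_radialSystem (hai n)
    exact hv.exists_normalized hnt
  choose u v hS hu1 hux using hex
  set β : ℝ := N * κ - N + 2 with hβdef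
  have hequ : ∀ ε > 0, ∃ δ > 0, ∀ r ∈ Icc (0:ℝ) 1, ∀ s ∈ Icc (0:ℝ) 1, |r - s| < δ →
      ∀ n, |u n r - u n s| ≤ ε := by
    intro ε hε
    have hG : UniformContinuousOn (fun r : ℝ => (μ + A) / β * r ^ β) (Icc 0 1) := by
      refine isCompact_Icc.uniformContinuousOn_of_continuous (Continuous.continuousOn ?_)
      exact continuous_const.mul (Real.continuous_rpow_const hβ.le)
    obtain ⟨δ, hδ, h⟩ := Metric.uniformContinuousOn_iff.1 hG ε hε
    have key : ∀ r ∈ Icc (0:ℝ) 1, ∀ s ∈ Icc (0:ℝ) 1, s ≤ r → |r - s| < δ →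
        ∀ n, |u n r - u n s| ≤ ε := by
      intro r hr s hs hsr hd n
      refine ((hS n).abs_sub_le hN (hai n) hA0 hκ hβ (haE n) (hu1 n) hs.1 hsr hr.2).trans ?_
      have := h r hr s hs hd
      rw [Real.dist_eq, ← mul_sub] at this
      exact (le_abs_self _).trans this.le
    refine ⟨δ, hδ, fun r hr s hs hd n => ?_⟩
    rcases le_total s r with hsr | hsr
    · exact key r hr s hs hsr hd n
    · rw [abs_sub_comm] at hd ⊢
      exact key s hs r hr hsr hd n
  have heqv : ∀ ε > 0, ∃ δ > 0, ∀ r ∈ Icc (0:ℝ) 1, ∀ s ∈ Icc (0:ℝ) 1, |r - s| < δ →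
      ∀ n, |v n r - v n s| ≤ ε := by
    intro ε hε
    have hG : Continuous (fun r : ℝ => (μ + A) * r ^ κ) :=
      continuous_const.mul (Real.continuous_rpow_const hκ.le)
    obtain ⟨δ, hδ, h⟩ := Metric.continuous_iff.1 hG 0 ε hε
    have key : ∀ r ∈ Icc (0:ℝ) 1, ∀ s ∈ Icc (0:ℝ) 1, s ≤ r → |r - s| < δ →
        ∀ n, |v n r - v n s| ≤ ε := by
      intro r hr s hs hsr hd n
      refine ((hS n).abs_flux_sub_le (hai n) hA0 hκ (haE n) (hu1 n) hs.1 hsr hr.2).trans ?_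
      have h1 := h (r - s) (by rwa [Real.dist_eq, sub_zero])
      rw [Real.dist_eq, Real.zero_rpow hκ.ne', mul_zero, sub_zero] at h1
      refine le_trans ?_ ((le_abs_self _).trans h1.le)
      refine mul_le_mul_of_nonneg_left (Real.rpow_le_rpow ?_ ?_ hκ.le) hA0
      · exact mul_nonneg (pow_nonneg hr.1 _) (sub_nonneg.2 hsr)
      · exact mul_le_of_le_one_left (sub_nonneg.2 hsr) (pow_le_one₀ hr.1 hr.2)
    refine ⟨δ, hδ, fun r hr s hs hd n => ?_⟩
    rcases le_total s r with hsr | hsr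
    · exact key r hr s hs hsr hd n
    · rw [abs_sub_comm] at hd ⊢
      exact key s hs r hr hsr hd n
  have hv1 : ∀ n, ∀ r ∈ Icc (0:ℝ) 1, |v n r| ≤ μ + A := by
    intro n r hr
    have := (hS n).abs_flux_sub_le (hai n) hA0 hκ (haE n) (hu1 n) le_rfl hr.1 hr.2
    rw [(hS n).flux_zero, sub_zero, sub_zero] at this
    refine this.trans (mul_le_of_le_one_right hA0 (Real.rpow_le_one ?_ ?_ hκ.le))
    · exact mul_nonneg (pow_nonneg hr.1 _) hr.1
    · exact mul_le_one₀ (pow_le_one₀ hr.1 hr.2) hr.1 hr.2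
  obtain ⟨u₀, hu₀c, hu₀1, hu₀⟩ := exists_uniformLimit_ultrafilter hu1 hequ U
  obtain ⟨v₀, hv₀c, -, hv₀⟩ := exists_uniformLimit_ultrafilter hv1 heqv U
  have hS₀ : RadialSystem N (fun r => μ + b₀ r) u₀ v₀ :=
    RadialSystem.of_tendsto hS hbi hb₀i hB hu₀c hv₀c hu₀1 hu₀ hv₀ hw
  have hnt : ∃ r ∈ Icc (0:ℝ) 1, u₀ r ≠ 0 := by
    obtain ⟨n, hn⟩ := (hu₀ (1 / 2) (by norm_num)).exists
    obtain ⟨r, hr, hr1⟩ := hux n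
    refine ⟨r, hr, fun h0 => ?_⟩
    have := hn r hr
    rw [h0, sub_zero, hr1] at this
    norm_num at this
  refine ⟨b₀, hb₀m, hb₀0, hb₀i, fun hzero => ?_, ?_, hw⟩
  · have hS₁ : RadialSystem N (fun _ => μ) u₀ v₀ := by
      refine ⟨hS₀.cont, fun r hr => ?_, hS₀.sub_eq, hS₀.neumann⟩
      rw [hS₀.flux r hr]
      congr 1
      refine integral_congr_ae (ae_restrict_of_ae ?_)
      filter_upwards [hzero] with x hx
      rw [hx, Pi.zero_apply, add_zero]
    obtain ⟨x, hx, hmin⟩ := isCompact_Icc.exists_isMinOn (s := Icc (0:ℝ) 1) ⟨0, by simp⟩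
      (hu₀c.abs.add hv₀c.abs).continuousOn
    have hc : 0 < |u₀ x| + |v₀ x| := by
      rcases hS₁.ne_zero_or_flux_ne_zero hμ hnt hx with h | h
      · exact add_pos_of_pos_of_nonneg (abs_pos.2 h) (abs_nonneg _)
      · exact add_pos_of_nonneg_of_pos (abs_nonneg _) (abs_pos.2 h)
    obtain ⟨n, hn1, hn2⟩ := ((hu₀ ((|u₀ x| + |v₀ x|) / 4) (by positivity)).and
      (hv₀ ((|u₀ x| + |v₀ x|) / 4) (by positivity))).exists
    have hae := (hS n).ae_eq_of_close hS₁ (hai n) (by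
      filter_upwards [hb0 n] with r hr
      exact le_add_of_nonneg_right hr) hc (fun r hr => hmin hr) hn1 hn2
    refine hbne n ?_
    filter_upwards [hae] with r hr
    simpa using hr
  · obtain ⟨w, hw, hwsol⟩ := hS₀.exists_isRadialNeumannSolution
      ((integrable_const μ).add hb₀i)
    obtain ⟨r, hr, hr0⟩ := hnt
    exact ⟨w, hwsol, r, hr, by rwa [hw hr]⟩

end Compactness

section Existence

variable {N : ℕ} {μ : ℝ}

/-- A piecewise differentiable solution of the first-order system is a `RadialSystem`. -/
lemma RadialSystem.of_hasDerivAt_off {a u v : ℝ → ℝ} {ρ : ℝ} (hu : Continuous u) (hv : Continuous v)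
    (ha : Integrable a (radialMeasure N)) (hv0 : v 0 = 0) (hv1 : v 1 = 0)
    (hdu : ∀ t ∈ Ioo (0:ℝ) 1, t ≠ ρ → HasDerivAt u (v t / t ^ (N - 1)) t)
    (hdv : ∀ t ∈ Ioo (0:ℝ) 1, t ≠ ρ → HasDerivAt v (-(t ^ (N - 1) * (a t * u t))) t) :
    RadialSystem N a u v := by
  refine ⟨hu.continuousOn, fun r hr => ?_, fun s r hs hsr hr => ?_, hv1⟩
  · have hi := intervalIntegrable_of_radialMeasure
      (ha.mul_continuousOn_radialMeasure hu.continuousOn) le_rfl hr.1 hr.2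
    have := integral_eq_of_hasDerivAt_off_countable_of_le v
      (fun t => -(t ^ (N - 1) * (a t * u t))) hr.1 (countable_singleton ρ) hv.continuousOn
      (fun t ht => hdv t ⟨ht.1.1, ht.1.2.trans_le hr.2⟩ ht.2) hi.neg
    rw [intervalIntegral.integral_neg, intervalIntegral_eq_radialMeasure N _ le_rfl hr.1 hr.2,
      hv0, sub_zero] at this
    exact this.symm
  · refine (integral_eq_of_hasDerivAt_off_countable_of_le u (fun t => v t / t ^ (N - 1)) hsr
      (countable_singleton ρ) hu.continuousOn
      (fun t ht => hdu t ⟨hs.trans ht.1.1, ht.1.2.trans_le hr⟩ ht.2) ?_).symm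
    refine ContinuousOn.intervalIntegrable ?_
    rw [uIcc_of_le hsr]
    exact hv.continuousOn.div (by fun_prop) fun t ht => pow_ne_zero _ (hs.trans_le ht.1).ne'

/-- A bounded potential above any prescribed level admitting a radial Neumann solution. -/
theorem exists_bounded_potential (hN : 2 ≤ N) (hμ : 0 ≤ μ) :
    ∃ a : ℝ → ℝ, Measurable a ∧ (∃ C, ∀ r ∈ Ioo (0:ℝ) 1, |a r| ≤ C) ∧
      (∀ r ∈ Ioo (0:ℝ) 1, μ < a r) ∧ ∃ u, IsRadialNeumannSolution N a u ∧ NontrivialSol u := by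
  set ρ : ℝ := 1 / (μ + 2) with hρdef
  have hρ0 : 0 < ρ := by positivity
  have hρ1 : ρ < 1 := by rw [hρdef, div_lt_one (by positivity)]; linarith
  set f : ℝ → ℝ := fun s => 1 / (max ρ s) ^ (N - 1) with hf
  have hmaxpos : ∀ s, 0 < max ρ s := fun s => hρ0.trans_le (le_max_left _ _)
  have hfc : Continuous f := by
    refine continuous_const.div (by fun_prop) fun s => pow_ne_zero _ (hmaxpos s).ne'
  have hfpos : ∀ s, 0 < f s := fun s => by have := hmaxpos s; positivity
  set τ : ℝ → ℝ := fun r => ∫ s in ρ..r, f s with hτ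
  have hτd : ∀ r, HasDerivAt τ (f r) r := fun r =>
    (hfc.integral_hasStrictDerivAt ρ r).hasDerivAt
  have hτc : Continuous τ := continuous_iff_continuousAt.2 fun r => (hτd r).continuousAt
  have hτρ : τ ρ = 0 := by simp [hτ]
  have hT : 0 < τ 1 := intervalIntegral.intervalIntegral_pos_of_pos
    (hfc.intervalIntegrable _ _) hfpos hρ1
  obtain ⟨m, hm⟩ := exists_nat_ge (((μ + 2) * τ 1 + Real.pi / 4) / Real.pi)
  set L : ℝ := (m * Real.pi - Real.pi / 4) / τ 1 with hL
  have hLT : L * τ 1 + Real.pi / 4 = m * Real.pi := by rw [hL]; field_simp; ring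
  have hL2 : μ + 2 ≤ L := by
    rw [div_le_iff₀ Real.pi_pos] at hm
    rw [hL, le_div_iff₀ hT]
    linarith
  have hL0 : 0 < L := by linarith
  have hden : 0 < 2 * ρ ^ N + L * ρ ^ 2 := by positivity
  set c : ℝ := L / (2 * ρ ^ N + L * ρ ^ 2) with hc
  have hc0 : 0 < c := by positivity
  have hcρ : L * (1 - c * ρ ^ 2) = 2 * c * ρ ^ N := by rw [hc]; field_simp; ring
  have hcρ1 : 0 < 1 - c * ρ ^ 2 := by
    by_contra! hcon
    have h1 := mul_nonpos_of_nonneg_of_nonpos hL0.le hcon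
    have h2 : 0 < 2 * c * ρ ^ N := by positivity
    linarith
  have hcin : ∀ r, 0 < r → r ≤ ρ → 1 - c * ρ ^ 2 ≤ 1 - c * r ^ 2 := by
    intro r h0 hr
    have := pow_le_pow_left₀ h0.le hr 2
    nlinarith
  have hcμ : μ < 2 * N * c := by
    have h1 : ρ ^ N ≤ ρ ^ 2 := pow_le_pow_of_le_one hρ0.le hρ1.le hN
    have h2 : 2 * ρ ^ N ≤ L * ρ ^ 2 := by nlinarith [pow_pos hρ0 2]
    have h3 : 1 ≤ 2 * (c * ρ ^ 2) := by
      rw [hc, div_mul_eq_mul_div, mul_div_assoc', le_div_iff₀ hden]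
      linarith
    have h4 : ρ * (μ + 2) = 1 := by rw [hρdef]; field_simp
    have hN' : (2:ℝ) ≤ N := by exact_mod_cast hN
    have h5 : μ * ρ ^ 2 < 1 := by nlinarith
    have h6 : μ * ρ ^ 2 < 2 * c * ρ ^ 2 := by linarith
    have h7 : μ < 2 * c := lt_of_mul_lt_mul_right h6 (by positivity)
    nlinarith
  set R : ℝ := (1 - c * ρ ^ 2) / Real.cos (Real.pi / 4) with hR
  have hcos : 0 < Real.cos (Real.pi / 4) := by rw [Real.cos_pi_div_four]; positivity
  have hRcos : R * Real.cos (Real.pi / 4) = 1 - c * ρ ^ 2 := by rw [hR]; field_simp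
  have hsin : Real.sin (Real.pi / 4) = Real.cos (Real.pi / 4) := by
    rw [Real.sin_pi_div_four, Real.cos_pi_div_four]
  set θ : ℝ → ℝ := fun r => L * τ r + Real.pi / 4 with hθ
  have hθd : ∀ r, HasDerivAt θ (L * f r) r := fun r => ((hτd r).const_mul L).add_const _
  have hθc : Continuous θ := (continuous_const.mul hτc).add continuous_const
  have hθρ : θ ρ = Real.pi / 4 := by simp [hθ, hτρ]
  set u : ℝ → ℝ := fun r => if r ≤ ρ then 1 - c * r ^ 2 else R * Real.cos (θ r) with hu
  set v : ℝ → ℝ := fun r => if r ≤ ρ then -(2 * c * r ^ N) else -(R * L * Real.sin (θ r)) with hv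
  set a : ℝ → ℝ := fun r => if r ≤ ρ then 2 * N * c / (1 - c * r ^ 2) else
    L ^ 2 / (r ^ (N - 1)) ^ 2 with ha
  have hpow : ∀ r : ℝ, 0 < r → r < 1 → (r ^ (N - 1)) ^ 2 ≤ 1 := fun r h0 h1 =>
    pow_le_one₀ (by positivity) (pow_le_one₀ h0.le h1.le)
  have hsplit : ∀ r : ℝ, r ^ N = r ^ (N - 1) * r := fun r => by
    rw [← pow_succ, Nat.sub_add_cancel (by omega)]
  have ham : Measurable a := Measurable.ite measurableSet_Iic (by fun_prop) (by fun_prop)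
  have haμ : ∀ r ∈ Ioo (0:ℝ) 1, μ < a r := by
    intro r hr
    by_cases h : r ≤ ρ
    · simp only [ha, if_pos h]
      have h1 := hcin r hr.1 h
      refine hcμ.trans_le ?_
      rw [le_div_iff₀ (by linarith)]
      have : 0 ≤ c * r ^ 2 := by positivity
      refine mul_le_of_le_one_right (by positivity) (by linarith)
    · simp only [ha, if_neg h]
      have : 0 < r := hr.1
      refine lt_of_lt_of_le ?_ (le_div_self (by positivity) (by positivity) (hpow r hr.1 hr.2))
      nlinarith
  have haC : ∀ r ∈ Ioo (0:ℝ) 1,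
      |a r| ≤ max (2 * N * c / (1 - c * ρ ^ 2)) (L ^ 2 / (ρ ^ (N - 1)) ^ 2) := by
    intro r hr
    rw [abs_of_nonneg (hμ.trans (haμ r hr).le)]
    by_cases h : r ≤ ρ
    · simp only [ha, if_pos h]
      refine le_max_of_le_left ?_
      exact div_le_div_of_nonneg_left (by positivity) hcρ1 (hcin r hr.1 h)
    · simp only [ha, if_neg h]
      refine le_max_of_le_right ?_
      push Not at h
      refine div_le_div_of_nonneg_left (by positivity) (by positivity) ?_
      exact pow_le_pow_left₀ (by positivity) (pow_le_pow_left₀ hρ0.le h.le _) 2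
  have hai : Integrable a (radialMeasure N) := by
    refine Integrable.of_bound ham.aestronglyMeasurable
      (max (2 * N * c / (1 - c * ρ ^ 2)) (L ^ 2 / (ρ ^ (N - 1)) ^ 2)) ?_
    filter_upwards [ae_radialMeasure_mem N] with r hr
    exact haC r hr
  have huc : Continuous u := by
    refine Continuous.if_le (by fun_prop) (by fun_prop) continuous_id continuous_const ?_
    rintro r rfl
    rw [hθρ, hRcos]
  have hvc : Continuous v := by
    refine Continuous.if_le (by fun_prop) (by fun_prop) continuous_id continuous_const ?_
    rintro r rfl
    rw [hθρ, hsin, ← hcρ, ← hRcos]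
    ring
  have hS : RadialSystem N a u v := by
    refine RadialSystem.of_hasDerivAt_off (ρ := ρ) huc hvc hai ?_ ?_ ?_ ?_
    · simp only [hv, if_pos hρ0.le]
      rw [zero_pow (by omega)]
      simp
    · simp only [hv, if_neg (not_le.2 hρ1)]
      simp only [hθ, hLT]
      rw [Real.sin_nat_mul_pi]
      simp
    · intro t ht hne
      have ht0 : t ≠ 0 := ht.1.ne'
      rcases lt_or_gt_of_ne hne with hlt | hgt
      · have h1 : HasDerivAt (fun r : ℝ => 1 - c * r ^ 2) (v t / t ^ (N - 1)) t := by
          have := ((hasDerivAt_pow 2 t).const_mul c).const_sub 1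
          refine this.congr_deriv ?_
          simp only [hv, if_pos hlt.le, hsplit]
          field_simp
          ring
        refine h1.congr_of_eventuallyEq ?_
        filter_upwards [Iio_mem_nhds hlt] with r hr
        exact if_pos (le_of_lt hr)
      · have h1 : HasDerivAt (fun r : ℝ => R * Real.cos (θ r)) (v t / t ^ (N - 1)) t := by
          refine ((hθd t).cos.const_mul R).congr_deriv ?_
          simp only [hv, if_neg (not_le.2 hgt), hf, max_eq_right hgt.le]
          field_simp
        refine h1.congr_of_eventuallyEq ?_
        filter_upwards [Ioi_mem_nhds hgt] with r hr
        exact if_neg (not_le.2 hr)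
    · intro t ht hne
      have ht0 : t ≠ 0 := ht.1.ne'
      rcases lt_or_gt_of_ne hne with hlt | hgt
      · have h1 : HasDerivAt (fun r : ℝ => -(2 * c * r ^ N))
            (-(t ^ (N - 1) * (a t * u t))) t := by
          refine ((hasDerivAt_pow N t).const_mul (2 * c)).neg.congr_deriv ?_
          have : 1 - c * t ^ 2 ≠ 0 := by
            have := hcin t ht.1 hlt.le
            linarith
          simp only [ha, hu, if_pos hlt.le]
          field_simp
        refine h1.congr_of_eventuallyEq ?_
        filter_upwards [Iio_mem_nhds hlt] with r hr
        exact if_pos (le_of_lt hr)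
      · have h1 : HasDerivAt (fun r : ℝ => -(R * L * Real.sin (θ r)))
            (-(t ^ (N - 1) * (a t * u t))) t := by
          refine ((hθd t).sin.const_mul (R * L)).neg.congr_deriv ?_
          simp only [ha, hu, if_neg (not_le.2 hgt), hf, max_eq_right hgt.le]
          field_simp
        refine h1.congr_of_eventuallyEq ?_
        filter_upwards [Ioi_mem_nhds hgt] with r hr
        exact if_neg (not_le.2 hr)
  obtain ⟨w, hw, hwsol⟩ := hS.exists_isRadialNeumannSolution hai
  refine ⟨a, ham, ⟨_, haC⟩, haμ, w, hwsol, 0, by simp, ?_⟩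
  rw [hw (by simp)]
  simp [hu, hρ0.le]

end Existence

section Lebesgue

lemma rpow_tangent_le {x y p : ℝ} (hp : 1 < p) (hx : 0 ≤ x) (hy : 0 ≤ y) :
    y ^ p + p * y ^ (p - 1) * x - p * y ^ p ≤ x ^ p := by
  rcases hy.eq_or_lt with rfl | hy
  · rw [Real.zero_rpow (by linarith), Real.zero_rpow (by linarith)]
    simpa using Real.rpow_nonneg hx p
  · have h := one_add_mul_self_le_rpow_one_add (s := x / y - 1)
      (by linarith [div_nonneg hx hy.le]) hp.le
    rw [add_sub_cancel, Real.div_rpow hx hy.le, le_div_iff₀ (Real.rpow_pos_of_pos hy p)] at h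
    refine le_trans (le_of_eq ?_) h
    rw [Real.rpow_sub_one hy.ne']
    field_simp
    ring

variable {α : Type*} [MeasurableSpace α] {ν : Measure α} [IsFiniteMeasure ν]

/-- Lower semicontinuity of the `L^p` norm with respect to weak limits. -/
lemma integral_rpow_le_of_weakLimit {p I : ℝ} (hp : 1 < p) {b : ℕ → α → ℝ} {b₀ : α → ℝ}
    {l : Filter ℕ} [l.NeBot] (hb0 : ∀ n, 0 ≤ᵐ[ν] b n) (hbi : ∀ n, Integrable (b n) ν)
    (hbp : ∀ n, Integrable (fun x => b n x ^ p) ν) (hb₀m : Measurable b₀) (hb₀0 : ∀ x, 0 ≤ b₀ x)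
    (hb₀i : Integrable b₀ ν) (hI : Tendsto (fun n => ∫ x, b n x ^ p ∂ν) l (𝓝 I))
    (hw : ∀ f : α → ℝ, Measurable f → (∃ K, ∀ x, |f x| ≤ K) →
      Tendsto (fun n => ∫ x, f x * b n x ∂ν) l (𝓝 (∫ x, f x * b₀ x ∂ν))) :
    Integrable (fun x => b₀ x ^ p) ν ∧ ∫ x, b₀ x ^ p ∂ν ≤ I := by
  have hp0 : 0 < p := by linarith
  have hmin0 : ∀ (K : ℕ) x, 0 ≤ min (b₀ x) K := fun K x => le_min (hb₀0 x) (Nat.cast_nonneg _)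
  have hminm : ∀ K : ℕ, Measurable fun x => min (b₀ x) (K:ℝ) := fun K => hb₀m.min measurable_const
  have hypi : ∀ K : ℕ, Integrable (fun x => min (b₀ x) (K:ℝ) ^ p) ν := by
    intro K
    refine Integrable.of_bound ((hminm K).pow_const p).aestronglyMeasurable ((K:ℝ) ^ p)
      (Eventually.of_forall fun x => ?_)
    rw [Real.norm_eq_abs, abs_of_nonneg (Real.rpow_nonneg (hmin0 K x) _)]
    exact Real.rpow_le_rpow (hmin0 K x) (min_le_right _ _) hp0.le
  have htrunc : ∀ K : ℕ, ∫ x, min (b₀ x) (K:ℝ) ^ p ∂ν ≤ I := by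
    intro K
    set f : α → ℝ := fun x => p * min (b₀ x) (K:ℝ) ^ (p - 1) with hf
    have hf0 : ∀ x, 0 ≤ f x := fun x => mul_nonneg hp0.le (Real.rpow_nonneg (hmin0 K x) _)
    have hfm : Measurable f := ((hminm K).pow_const _).const_mul p
    have hfK : ∀ x, |f x| ≤ p * (K:ℝ) ^ (p - 1) := by
      intro x
      rw [abs_of_nonneg (hf0 x)]
      exact mul_le_mul_of_nonneg_left
        (Real.rpow_le_rpow (hmin0 K x) (min_le_right _ _) (by linarith)) hp0.le
    have hfb : ∀ g : α → ℝ, Integrable g ν → Integrable (fun x => f x * g x) ν := fun g hg =>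
      hg.bdd_mul hfm.aestronglyMeasurable (Eventually.of_forall hfK)
    have h1 : ∀ n, ∫ x, min (b₀ x) (K:ℝ) ^ p ∂ν + ∫ x, f x * b n x ∂ν -
        p * ∫ x, min (b₀ x) (K:ℝ) ^ p ∂ν ≤ ∫ x, b n x ^ p ∂ν := by
      intro n
      have hA : Integrable (fun x => min (b₀ x) (K:ℝ) ^ p + f x * b n x) ν :=
        (hypi K).add (hfb _ (hbi n))
      rw [← integral_const_mul, ← integral_add (hypi K) (hfb _ (hbi n)),
        ← integral_sub hA ((hypi K).const_mul p)]
      refine integral_mono_ae (hA.sub ((hypi K).const_mul p)) (hbp n) ?_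
      filter_upwards [hb0 n] with x hx
      exact rpow_tangent_le hp hx (hmin0 K x)
    have h2 := le_of_tendsto_of_tendsto
      (((tendsto_const_nhds (x := ∫ x, min (b₀ x) (K:ℝ) ^ p ∂ν)).add (hw f hfm ⟨_, hfK⟩)).sub_const
        (p * ∫ x, min (b₀ x) (K:ℝ) ^ p ∂ν)) hI (Eventually.of_forall h1)
    have h3 : p * ∫ x, min (b₀ x) (K:ℝ) ^ p ∂ν ≤ ∫ x, f x * b₀ x ∂ν := by
      rw [← integral_const_mul]
      refine integral_mono ((hypi K).const_mul p) (hfb _ hb₀i) fun x => ?_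
      have e : p * min (b₀ x) (K:ℝ) ^ p = f x * min (b₀ x) (K:ℝ) := by
        rw [hf, mul_assoc]
        congr 1
        rcases (hmin0 K x).eq_or_lt with h0 | h0
        · rw [← h0, mul_zero, Real.zero_rpow hp0.ne']
        · rw [Real.rpow_sub_one h0.ne']
          field_simp
      show p * min (b₀ x) (K:ℝ) ^ p ≤ f x * b₀ x
      rw [e]
      exact mul_le_mul_of_nonneg_left (min_le_left _ _) (hf0 x)
    linarith
  have hI0 : 0 ≤ I := (integral_nonneg fun x => Real.rpow_nonneg (hmin0 0 x) p).trans (htrunc 0)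
  have hlim : Tendsto (fun K : ℕ => ∫⁻ x, ENNReal.ofReal (min (b₀ x) (K:ℝ) ^ p) ∂ν) atTop
      (𝓝 (∫⁻ x, ENNReal.ofReal (b₀ x ^ p) ∂ν)) := by
    refine lintegral_tendsto_of_tendsto_of_monotone
      (fun K => ((hminm K).pow_const p).ennreal_ofReal.aemeasurable)
      (Eventually.of_forall fun x K K' hK => ?_) (Eventually.of_forall fun x => ?_)
    · exact ENNReal.ofReal_le_ofReal (Real.rpow_le_rpow (hmin0 K x)
        (min_le_min le_rfl (Nat.cast_le.2 hK)) hp0.le)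
    · refine tendsto_const_nhds.congr' ?_
      filter_upwards [eventually_ge_atTop ⌈b₀ x⌉₊] with K hK
      rw [min_eq_left (Nat.ceil_le.1 hK)]
  have hle : ∫⁻ x, ENNReal.ofReal (b₀ x ^ p) ∂ν ≤ ENNReal.ofReal I := by
    refine le_of_tendsto hlim (Eventually.of_forall fun K => ?_)
    rw [← ofReal_integral_eq_lintegral_ofReal (hypi K)
      (Eventually.of_forall fun x => Real.rpow_nonneg (hmin0 K x) p)]
    exact ENNReal.ofReal_le_ofReal (htrunc K)
  have h0 : 0 ≤ᵐ[ν] fun x => b₀ x ^ p :=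
    Eventually.of_forall fun x => Real.rpow_nonneg (hb₀0 x) p
  have hInt : Integrable (fun x => b₀ x ^ p) ν :=
    ⟨(hb₀m.pow_const p).aestronglyMeasurable,
      (hasFiniteIntegral_iff_ofReal h0).2 (hle.trans_lt ENNReal.ofReal_lt_top)⟩
  refine ⟨hInt, ?_⟩
  rw [← ofReal_integral_eq_lintegral_ofReal hInt h0] at hle
  exact (ENNReal.ofReal_le_ofReal_iff hI0).1 hle

lemma setIntegral_le_rpow_of_integral_rpow_le {p D : ℝ} (hp : 1 < p) {b : α → ℝ}
    (hb0 : 0 ≤ᵐ[ν] b) (hb : MemLp b (ENNReal.ofReal p) ν) (hD : ∫ x, b x ^ p ∂ν ≤ D) (E : Set α) :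
    ∫ x in E, b x ∂ν ≤ D ^ (1 / p) * (ν.real E) ^ (1 - 1 / p) := by
  have hp0 : 0 < p := by linarith
  have hpq := Real.HolderConjugate.conjExponent hp
  have hq : 1 / p.conjExponent = 1 - 1 / p := by
    have := hpq.inv_add_inv_eq_inv
    rw [inv_one] at this
    rw [one_div, one_div]
    linarith
  have h := integral_mul_le_Lp_mul_Lq_of_nonneg hpq (μ := ν.restrict E) (f := b)
    (g := fun _ => (1:ℝ)) (ae_restrict_of_ae hb0) (Eventually.of_forall fun _ => zero_le_one)
    (hb.restrict E) (memLp_const _)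
  simp only [mul_one, Real.one_rpow, integral_const, smul_eq_mul, measureReal_restrict_apply_univ,
    hq] at h
  refine h.trans (mul_le_mul_of_nonneg_right ?_ (by positivity))
  have hrp : 0 ≤ᵐ[ν] fun x => b x ^ p := by
    filter_upwards [hb0] with x hx
    exact Real.rpow_nonneg hx p
  have hInt : Integrable (fun x => b x ^ p) ν := by
    have := (integrable_norm_rpow_iff hb.1 (by simpa using hp0) ENNReal.ofReal_ne_top).2 hb
    rw [ENNReal.toReal_ofReal hp0.le] at this
    refine this.congr ?_
    filter_upwards [hb0] with x hx
    rw [Real.norm_of_nonneg hx]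
  refine Real.rpow_le_rpow (integral_nonneg_of_ae (ae_restrict_of_ae hrp)) ?_ (by positivity)
  exact (setIntegral_le_integral hInt hrp).trans hD

end Lebesgue

section Attained

variable {N : ℕ} {μ : ℝ} {a : ℝ → ℝ}

lemma radialMemLp_iff_memLp {p : ℝ} (hp : 0 < p) (ha : Measurable a) :
    RadialMemLp N p a ↔ MemLp a (ENNReal.ofReal p) (radialMeasure N) := by
  rw [← integrable_norm_rpow_iff ha.aestronglyMeasurable (by simpa using hp)
    ENNReal.ofReal_ne_top, ENNReal.toReal_ofReal hp.le, integrable_radialMeasure_iff]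
  rfl

lemma radialLpNorm_eq (N : ℕ) (p : ℝ) (a : ℝ → ℝ) :
    radialLpNorm N p a = (omegaN N * ∫ r, |a r| ^ p ∂(radialMeasure N)) ^ (1 / p) := by
  rw [integral_radialMeasure, ← integral_Ioc_eq_integral_Ioo,
    ← intervalIntegral.integral_of_le zero_le_one]
  rfl

lemma omegaN_pos (hN : 2 ≤ N) : 0 < omegaN N := by
  have : (0:ℝ) < N := by exact_mod_cast (by omega : 0 < N)
  refine mul_pos this (ENNReal.toReal_pos ?_ ?_)
  · exact (Metric.measure_ball_pos volume _ one_pos).ne'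
  · exact measure_ball_lt_top.ne

lemma radialLpNorm_nonneg (hN : 2 ≤ N) (p : ℝ) (a : ℝ → ℝ) : 0 ≤ radialLpNorm N p a := by
  rw [radialLpNorm_eq]
  exact Real.rpow_nonneg (mul_nonneg (omegaN_pos hN).le
    (integral_nonneg fun r => Real.rpow_nonneg (abs_nonneg _) _)) _

lemma radialMemLinfty_iff (N : ℕ) :
    RadialMemLinfty a ↔ ∃ C, ∀ᵐ r ∂(radialMeasure N), |a r| ≤ C :=
  exists_congr fun _ => (ae_radialMeasure_iff N _).symm

lemma prec_iff (N : ℕ) :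
    Prec μ a ↔ (0 ≤ᵐ[radialMeasure N] fun r => a r - μ) ∧
      ¬ (fun r => a r - μ) =ᵐ[radialMeasure N] 0 := by
  have h1 : (∀ᵐ r ∂(volume.restrict (Ioo (0:ℝ) 1)), μ ≤ a r) ↔
      (0 ≤ᵐ[radialMeasure N] fun r => a r - μ) := by
    rw [← ae_radialMeasure_iff N]
    refine eventually_congr (Eventually.of_forall fun r => ?_)
    exact sub_nonneg.symm
  rw [Prec, h1]
  refine and_congr_right fun h => ?_
  rw [pos_iff_ne_zero, not_iff_not, measure_eq_zero_iff_ae_notMem]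
  have h2 : ((fun r => a r - μ) =ᵐ[radialMeasure N] 0) ↔
      ∀ᵐ r ∂(radialMeasure N), ¬ μ < a r := by
    constructor
    · intro h'
      filter_upwards [h'] with r hr
      rw [Pi.zero_apply, sub_eq_zero] at hr
      exact hr.le.not_gt
    · intro h'
      filter_upwards [h', h] with r hr hr2
      exact le_antisymm (sub_nonpos.2 (not_lt.1 hr)) hr2
  rw [h2, ae_radialMeasure_iff, ae_restrict_iff' measurableSet_Ioo]
  refine eventually_congr (Eventually.of_forall fun r => ?_)
  simp only [mem_ofPred_eq, not_and]

lemma gammaSet_of_radialMemLp {p : ℝ} (hN : 2 ≤ N) (hp : (N:ℝ) / 2 < p) (ham : Measurable a)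
    (haμ : Prec μ a) (hu : ∃ u, IsRadialNeumannSolution N a u ∧ NontrivialSol u)
    (hap : RadialMemLp N p a) : GammaSet N μ a := by
  have hN0 : (2:ℝ) ≤ N := by exact_mod_cast hN
  refine ⟨ham, haμ, hu, ?_⟩
  split_ifs with h
  · rw [radialMemLp_iff_memLp (by linarith) ham] at hap ⊢
    exact hap.mono_exponent (ENNReal.ofReal_le_ofReal hp.le)
  · exact Or.inl ⟨p, by linarith, hap⟩

lemma radialMemLp_of_radialMemLinfty {p : ℝ} (hp : 0 < p) (ham : Measurable a)
    (ha : RadialMemLinfty a) : RadialMemLp N p a := by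
  obtain ⟨C, hC⟩ := (radialMemLinfty_iff N).1 ha
  rw [radialMemLp_iff_memLp hp ham]
  exact MemLp.of_bound ham.aestronglyMeasurable C hC

lemma exists_gammaSet_radialMemLinfty (hN : 2 ≤ N) (hμ : 0 ≤ μ) :
    ∃ a, GammaSet N μ a ∧ RadialMemLinfty a := by
  obtain ⟨a, ham, ⟨C, hC⟩, haμ, hu⟩ := exists_bounded_potential (N := N) hN hμ
  have hinf : RadialMemLinfty a := ⟨C, (ae_restrict_mem measurableSet_Ioo).mono hC⟩
  refine ⟨a, gammaSet_of_radialMemLp hN (lt_add_one _) ham ⟨?_, ?_⟩ hu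
    (radialMemLp_of_radialMemLinfty (by positivity) ham hinf), hinf⟩
  · exact (ae_restrict_mem measurableSet_Ioo).mono fun r hr => (haμ r hr).le
  · have : {r ∈ Ioo (0:ℝ) 1 | μ < a r} = Ioo 0 1 := by
      ext r
      exact ⟨fun h => h.1, fun h => ⟨h, haμ r h⟩⟩
    rw [this]
    simp

/-- The finite-exponent Lyapunov constant is attained. -/
theorem exists_eq_gammaLyap (hN : 2 ≤ N) (hμ : 0 ≤ μ) {p : ℝ} (hp : (N:ℝ) / 2 < p) :
    ∃ a₀ : ℝ → ℝ, GammaSet N μ a₀ ∧ RadialMemLp N p a₀ ∧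
      radialLpNorm N p (fun r => a₀ r - μ) = gammaLyap N μ p := by
  have hN0 : (2:ℝ) ≤ N := by exact_mod_cast hN
  have hp1 : 1 < p := by linarith
  have hp0 : 0 < p := by linarith
  have hω := omegaN_pos hN
  set S : Set ℝ := {t : ℝ | ∃ a : ℝ → ℝ, GammaSet N μ a ∧ RadialMemLp N p a ∧
    t = radialLpNorm N p (fun r => a r - μ)} with hS
  have hSne : S.Nonempty := by
    obtain ⟨a, ha, hinf⟩ := exists_gammaSet_radialMemLinfty hN hμ
    exact ⟨_, a, ha, radialMemLp_of_radialMemLinfty hp0 ha.1 hinf, rfl⟩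
  have hSb : BddBelow S := ⟨0, by rintro t ⟨a, -, -, rfl⟩; exact radialLpNorm_nonneg hN _ _⟩
  have hγ : gammaLyap N μ p = sInf S := rfl
  have hγ0 : 0 ≤ gammaLyap N μ p :=
    le_csInf hSne (by rintro t ⟨a, -, -, rfl⟩; exact radialLpNorm_nonneg hN _ _)
  obtain ⟨t, -, htlim, htS⟩ := exists_seq_tendsto_sInf hSne hSb
  choose a haΓ hap hat using htS
  set b : ℕ → ℝ → ℝ := fun n r => a n r - μ with hb
  have hbm : ∀ n, Measurable (b n) := fun n => (haΓ n).1.sub_const μ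
  have hb0 : ∀ n, 0 ≤ᵐ[radialMeasure N] b n := fun n => ((prec_iff N).1 (haΓ n).2.1).1
  have hbne : ∀ n, ¬ b n =ᵐ[radialMeasure N] 0 := fun n => ((prec_iff N).1 (haΓ n).2.1).2
  have hbLp : ∀ n, MemLp (b n) (ENNReal.ofReal p) (radialMeasure N) := fun n =>
    ((radialMemLp_iff_memLp hp0 (haΓ n).1).1 (hap n)).sub (memLp_const μ)
  have hbi : ∀ n, Integrable (b n) (radialMeasure N) := fun n =>
    (hbLp n).integrable (by rw [ENNReal.one_le_ofReal]; exact hp1.le)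
  have habs : ∀ n, (fun r => |b n r| ^ p) =ᵐ[radialMeasure N] fun r => b n r ^ p := by
    intro n
    filter_upwards [hb0 n] with r hr
    rw [abs_of_nonneg hr]
  have hbp : ∀ n, Integrable (fun r => b n r ^ p) (radialMeasure N) := by
    intro n
    have := (integrable_norm_rpow_iff (hbLp n).1 (by simpa using hp0)
      ENNReal.ofReal_ne_top).2 (hbLp n)
    rw [ENNReal.toReal_ofReal hp0.le] at this
    exact this.congr (habs n)
  have hI : ∀ n, ∫ r, b n r ^ p ∂(radialMeasure N) = t n ^ p / omegaN N := by
    intro n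
    have h0 : 0 ≤ ∫ r, |b n r| ^ p ∂(radialMeasure N) :=
      integral_nonneg fun r => Real.rpow_nonneg (abs_nonneg _) _
    rw [hat n, radialLpNorm_eq, ← Real.rpow_mul (mul_nonneg hω.le h0), one_div,
      inv_mul_cancel₀ hp0.ne', Real.rpow_one, mul_div_cancel_left₀ _ hω.ne']
    exact (integral_congr_ae (habs n)).symm
  have hIlim : Tendsto (fun n => ∫ r, b n r ^ p ∂(radialMeasure N)) atTop
      (𝓝 (gammaLyap N μ p ^ p / omegaN N)) := by
    simp_rw [hI]
    exact (((Real.continuous_rpow_const hp0.le).tendsto _).comp htlim).div_const _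
  obtain ⟨D, hD⟩ := hIlim.bddAbove_range
  have hDn : ∀ n, ∫ r, b n r ^ p ∂(radialMeasure N) ≤ D := fun n => hD ⟨n, rfl⟩
  have hD0 : 0 ≤ D := by
    refine le_trans (integral_nonneg_of_ae ?_) (hDn 0)
    filter_upwards [hb0 0] with r hr
    exact Real.rpow_nonneg hr p
  have hpinv : 1 / p < 1 := by rw [div_lt_one hp0]; exact hp1
  have hβ : 0 < N * (1 - 1 / p) - N + 2 := by
    have : (N:ℝ) / p < 2 := by
      rw [div_lt_iff₀ hp0]
      linarith
    have e : (N:ℝ) * (1 - 1 / p) - N + 2 = 2 - N / p := by ring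
    linarith
  obtain ⟨b₀, hb₀m, hb₀0, hb₀i, hb₀ne, hb₀sol, hw⟩ := exists_limit_potential (A := D ^ (1 / p)) hN hμ
    (by linarith) (by linarith [one_div_pos.2 hp0] : 1 - 1 / p ≤ 1) hβ (by positivity)
    hbi hb0 hbne
    (fun n E _ => setIntegral_le_rpow_of_integral_rpow_le hp1 (hb0 n) (hbLp n) (hDn n) E)
    (fun n => by
      have e : (fun r => μ + b n r) = a n := by ext r; simp [hb]
      rw [e]
      exact (haΓ n).2.2.1) (hyperfilter ℕ)
  obtain ⟨hb₀p, hb₀I⟩ := integral_rpow_le_of_weakLimit hp1 hb0 hbi hbp hb₀m hb₀0 hb₀i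
    (hIlim.mono_left Nat.hyperfilter_le_atTop) hw
  have hb₀Lp : MemLp b₀ (ENNReal.ofReal p) (radialMeasure N) := by
    rw [← integrable_norm_rpow_iff hb₀m.aestronglyMeasurable (by simpa using hp0)
      ENNReal.ofReal_ne_top, ENNReal.toReal_ofReal hp0.le]
    simpa only [Real.norm_of_nonneg (hb₀0 _)] using hb₀p
  have ha₀m : Measurable fun r => μ + b₀ r := hb₀m.const_add μ
  have ha₀Lp : RadialMemLp N p fun r => μ + b₀ r :=
    (radialMemLp_iff_memLp hp0 ha₀m).2 ((memLp_const μ).add hb₀Lp)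
  have ha₀Γ : GammaSet N μ fun r => μ + b₀ r := by
    refine gammaSet_of_radialMemLp hN hp ha₀m ((prec_iff N).2 ?_) hb₀sol ha₀Lp
    simp only [add_sub_cancel_left]
    exact ⟨Eventually.of_forall hb₀0, hb₀ne⟩
  refine ⟨_, ha₀Γ, ha₀Lp, le_antisymm ?_ (csInf_le hSb ⟨_, ha₀Γ, ha₀Lp, rfl⟩)⟩
  rw [radialLpNorm_eq]
  simp only [add_sub_cancel_left, abs_of_nonneg (hb₀0 _)]
  have h0 : 0 ≤ ∫ r, b₀ r ^ p ∂(radialMeasure N) :=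
    integral_nonneg fun r => Real.rpow_nonneg (hb₀0 r) p
  have h1 : omegaN N * ∫ r, b₀ r ^ p ∂(radialMeasure N) ≤ gammaLyap N μ p ^ p := by
    rw [le_div_iff₀ hω] at hb₀I
    linarith
  refine (Real.rpow_le_rpow (mul_nonneg hω.le h0) h1 (by positivity)).trans (le_of_eq ?_)
  rw [← Real.rpow_mul hγ0, mul_one_div_cancel hp0.ne', Real.rpow_one]

lemma neBot_ae_restrict_Ioo : (ae (volume.restrict (Ioo (0:ℝ) 1))).NeBot := by
  rw [ae_neBot, Ne, Measure.restrict_eq_zero]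
  simp

lemma isCoboundedUnder_abs (a : ℝ → ℝ) :
    IsCoboundedUnder (· ≤ ·) (ae (volume.restrict (Ioo (0:ℝ) 1))) fun r => |a r| := by
  have := neBot_ae_restrict_Ioo
  exact IsBoundedUnder.isCoboundedUnder_le (isBoundedUnder_of ⟨0, fun r => abs_nonneg _⟩)

lemma ae_abs_le_radialLinftyNorm (ha : RadialMemLinfty a) :
    ∀ᵐ r ∂(volume.restrict (Ioo (0:ℝ) 1)), |a r| ≤ radialLinftyNorm a := by
  obtain ⟨C, hC⟩ := ha
  exact ae_le_essSup (isBoundedUnder_of_eventually_le hC)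

lemma radialLinftyNorm_le {C : ℝ} (ha : ∀ᵐ r ∂(volume.restrict (Ioo (0:ℝ) 1)), |a r| ≤ C) :
    radialLinftyNorm a ≤ C :=
  essSup_le_of_ae_le C ha (isCoboundedUnder_abs a)

lemma radialLinftyNorm_nonneg (ha : RadialMemLinfty a) : 0 ≤ radialLinftyNorm a := by
  have := neBot_ae_restrict_Ioo
  obtain ⟨r, hr⟩ := (ae_abs_le_radialLinftyNorm ha).exists
  exact (abs_nonneg _).trans hr

lemma RadialMemLinfty.sub_const (ha : RadialMemLinfty a) (μ : ℝ) :
    RadialMemLinfty fun r => a r - μ := by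
  obtain ⟨C, hC⟩ := ha
  refine ⟨C + |μ|, ?_⟩
  filter_upwards [hC] with r hr
  exact (abs_sub _ _).trans (by linarith)

/-- The Lyapunov constant for `p = ∞` is attained. -/
theorem exists_eq_gammaLyapInfty (hN : 2 ≤ N) (hμ : 0 ≤ μ) :
    ∃ a₀ : ℝ → ℝ, GammaSet N μ a₀ ∧ RadialMemLinfty a₀ ∧
      radialLinftyNorm (fun r => a₀ r - μ) = gammaLyapInfty N μ := by
  set S : Set ℝ := {t : ℝ | ∃ a : ℝ → ℝ, GammaSet N μ a ∧ RadialMemLinfty a ∧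
    t = radialLinftyNorm (fun r => a r - μ)} with hS
  have hSne : S.Nonempty := by
    obtain ⟨a, ha, hinf⟩ := exists_gammaSet_radialMemLinfty hN hμ
    exact ⟨_, a, ha, hinf, rfl⟩
  have hSb : BddBelow S :=
    ⟨0, by rintro t ⟨a, -, ha, rfl⟩; exact radialLinftyNorm_nonneg (ha.sub_const μ)⟩
  have hγ : gammaLyapInfty N μ = sInf S := rfl
  obtain ⟨t, -, htlim, htS⟩ := exists_seq_tendsto_sInf hSne hSb
  rw [← hγ] at htlim
  choose a haΓ hai hat using htS
  set b : ℕ → ℝ → ℝ := fun n r => a n r - μ with hb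
  have hbm : ∀ n, Measurable (b n) := fun n => (haΓ n).1.sub_const μ
  have hb0 : ∀ n, 0 ≤ᵐ[radialMeasure N] b n := fun n => ((prec_iff N).1 (haΓ n).2.1).1
  have hbne : ∀ n, ¬ b n =ᵐ[radialMeasure N] 0 := fun n => ((prec_iff N).1 (haΓ n).2.1).2
  have hbt : ∀ n, ∀ᵐ r ∂(radialMeasure N), |b n r| ≤ t n := by
    intro n
    rw [hat n, ae_radialMeasure_iff]
    exact ae_abs_le_radialLinftyNorm ((hai n).sub_const μ)
  have hbi : ∀ n, Integrable (b n) (radialMeasure N) := fun n =>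
    Integrable.of_bound (hbm n).aestronglyMeasurable (t n) (hbt n)
  have hbE : ∀ n (E : Set ℝ), ∫ x in E, b n x ∂(radialMeasure N) ≤
      t n * (radialMeasure N).real E := by
    intro n E
    have := setIntegral_mono_ae (s := E) (hbi n).integrableOn
      (integrable_const (μ := radialMeasure N) (t n)).integrableOn
      ((hbt n).mono fun x hx => (le_abs_self _).trans hx)
    rwa [setIntegral_const, smul_eq_mul, mul_comm] at this
  obtain ⟨D, hD⟩ := htlim.bddAbove_range
  have hDn : ∀ n, t n ≤ D := fun n => hD ⟨n, rfl⟩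
  have hD0 : 0 ≤ D := by
    refine le_trans ?_ (hDn 0)
    rw [hat 0]
    exact radialLinftyNorm_nonneg ((hai 0).sub_const μ)
  obtain ⟨b₀, hb₀m, hb₀0, hb₀i, hb₀ne, hb₀sol, hw⟩ := exists_limit_potential (A := D) hN hμ
    one_pos le_rfl (by linarith : (0:ℝ) < N * 1 - N + 2) hD0 hbi hb0 hbne
    (fun n E _ => by
      rw [Real.rpow_one]
      exact (hbE n E).trans (mul_le_mul_of_nonneg_right (hDn n) measureReal_nonneg))
    (fun n => by
      have e : (fun r => μ + b n r) = a n := by ext r; simp [hb]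
      rw [e]
      exact (haΓ n).2.2.1) (hyperfilter ℕ)
  have hb₀γ : ∀ᵐ r ∂(radialMeasure N), b₀ r ≤ gammaLyapInfty N μ := by
    refine ae_le_of_forall_setIntegral_le hb₀i (integrable_const _) fun E hE _ => ?_
    rw [setIntegral_const, smul_eq_mul, mul_comm]
    have hconv : ∀ g : ℝ → ℝ, ∫ x, E.indicator 1 x * g x ∂(radialMeasure N) =
        ∫ x in E, g x ∂(radialMeasure N) := by
      intro g
      rw [← integral_indicator hE]
      congr 1
      ext x
      by_cases hx : x ∈ E <;> simp [hx]
    have h1 := hw (E.indicator 1) (measurable_one.indicator hE) ⟨1, fun x => by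
      by_cases hx : x ∈ E <;> simp [hx]⟩
    simp_rw [hconv] at h1
    exact le_of_tendsto_of_tendsto h1
      ((htlim.mono_left Nat.hyperfilter_le_atTop).mul_const _)
      (Eventually.of_forall fun n => hbE n E)
  have ha₀m : Measurable fun r => μ + b₀ r := hb₀m.const_add μ
  have hb₀γ' : ∀ᵐ r ∂(volume.restrict (Ioo (0:ℝ) 1)), |b₀ r| ≤ gammaLyapInfty N μ := by
    rw [← ae_radialMeasure_iff N]
    filter_upwards [hb₀γ] with r hr
    rwa [abs_of_nonneg (hb₀0 r)]
  have ha₀inf : RadialMemLinfty fun r => μ + b₀ r := by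
    refine ⟨|μ| + gammaLyapInfty N μ, ?_⟩
    filter_upwards [hb₀γ'] with r hr
    exact (abs_add_le _ _).trans (by linarith)
  have ha₀Γ : GammaSet N μ fun r => μ + b₀ r := by
    refine gammaSet_of_radialMemLp hN (lt_add_one _) ha₀m ((prec_iff N).2 ?_) hb₀sol
      (radialMemLp_of_radialMemLinfty (by positivity) ha₀m ha₀inf)
    simp only [add_sub_cancel_left]
    exact ⟨Eventually.of_forall hb₀0, hb₀ne⟩
  refine ⟨_, ha₀Γ, ha₀inf, le_antisymm ?_ (csInf_le hSb ⟨_, ha₀Γ, ha₀inf, rfl⟩)⟩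
  simp only [add_sub_cancel_left]
  exact radialLinftyNorm_le hb₀γ'

end Attained

/-- For `N ≥ 2`, `k ≥ 0` and `N/2 < p ≤ ∞`, the infimum `γ_{p,k}` is attained
at some `a₀ ∈ Γ_k ∩ L^p(B_1)`. -/
theorem stmt2 (N k : ℕ) (hN : 2 ≤ N) (μk : ℝ) (φk : ℝ → ℝ) (rz : ℕ → ℝ)
    (hek : IsRadialNeumannEigenpair N k μk φk rz) :
    (∀ p : ℝ, (N : ℝ) / 2 < p →
      ∃ a₀ : ℝ → ℝ, GammaSet N μk a₀ ∧ RadialMemLp N p a₀ ∧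
        radialLpNorm N p (fun r => a₀ r - μk) = gammaLyap N μk p) ∧
    (∃ a₀ : ℝ → ℝ, GammaSet N μk a₀ ∧ RadialMemLinfty a₀ ∧
        radialLinftyNorm (fun r => a₀ r - μk) = gammaLyapInfty N μk) := by
  exact ⟨fun p hp => exists_eq_gammaLyap hN hek.1 hp, exists_eq_gammaLyapInfty hN hek.1⟩
end
end

section
/- Let k ≥ 0, a ∈ Γ_k, and let u be any nontrivial radial Neumann solution of Δu + a u = 0 on B_1. Then u has at least k+1 zeros in the interval (0,1). -/
open MeasureTheory Set Filter

noncomputable section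

/-- A radial Neumann solution is continuously differentiable away from the origin, hence
absolutely continuous there. -/
theorem IsRadialNeumannSolutionDeriv.absolutelyContinuous {N : ℕ} {a u u' : ℝ → ℝ}
    (hA : IntervalIntegrable (fun s => s ^ (N - 1) * a s) volume 0 1)
    (hu : IsRadialNeumannSolutionDeriv N a u u') {ε : ℝ} (hε : 0 < ε) (hε1 : ε ≤ 1) :
    AbsolutelyContinuousOnInterval u ε 1 := by
  obtain ⟨huc, hud, hui, -⟩ := hu
  have h01 : uIcc (0:ℝ) 1 = Icc 0 1 := uIcc_of_le zero_le_one
  have hf : IntervalIntegrable (fun s => s ^ (N - 1) * a s * u s) volume 0 1 :=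
    hA.mul_continuousOn (by rwa [h01])
  have hsub : Icc ε 1 ⊆ Ioc (0:ℝ) 1 := fun x hx => ⟨hε.trans_le hx.1, hx.2⟩
  have hP : ContinuousOn (fun r => ∫ s in (0:ℝ)..r, s ^ (N - 1) * a s * u s) (Icc 0 1) := by
    have := (hf.absolutelyContinuousOnInterval_intervalIntegral left_mem_uIcc).continuousOn
    rwa [h01] at this
  have hc : ContinuousOn u' (Icc ε 1) := by
    have h : ContinuousOn
        (fun r => (-∫ s in (0:ℝ)..r, s ^ (N - 1) * a s * u s) / r ^ (N - 1)) (Icc ε 1) :=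
      ((hP.mono (hsub.trans Ioc_subset_Icc_self)).neg).div (by fun_prop)
        fun x hx => pow_ne_zero _ (hsub hx).1.ne'
    refine h.congr fun x hx => ?_
    rw [eq_div_iff (pow_ne_zero _ (hsub hx).1.ne'), ← hui x (hsub hx), mul_comm]
  obtain ⟨C, hC⟩ := isCompact_Icc.exists_bound_of_continuousOn hc
  have hL : LipschitzOnWith C.toNNReal u (uIcc ε 1) := by
    rw [uIcc_of_le hε1]
    refine (convex_Icc ε 1).lipschitzOnWith_of_nnnorm_hasDerivWithin_le
      (fun x hx => (hud x (hsub hx)).hasDerivWithinAt) fun x hx => ?_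
    rw [← NNReal.coe_le_coe, coe_nnnorm]
    exact (hC x hx).trans (Real.le_coe_toNNReal C)
  exact hL.absolutelyContinuousOnInterval

/-- The integrated Lagrange identity for two radial Neumann solutions. -/
theorem IsRadialNeumannSolutionDeriv.wronskian_eq {N : ℕ} (hN : 2 ≤ N) {a b u u' v v' : ℝ → ℝ}
    (hA : IntervalIntegrable (fun s => s ^ (N - 1) * a s) volume 0 1)
    (hB : IntervalIntegrable (fun s => s ^ (N - 1) * b s) volume 0 1)
    (hu : IsRadialNeumannSolutionDeriv N a u u') (hv : IsRadialNeumannSolutionDeriv N b v v')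
    {r : ℝ} (hr : r ∈ Icc (0:ℝ) 1) :
    r ^ (N - 1) * (u' r * v r - u r * v' r) =
      -∫ s in (0:ℝ)..r, s ^ (N - 1) * (a s - b s) * (u s * v s) := by
  have h01 : uIcc (0:ℝ) 1 = Icc 0 1 := uIcc_of_le zero_le_one
  have hf : IntervalIntegrable (fun s => s ^ (N - 1) * a s * u s) volume 0 1 :=
    hA.mul_continuousOn (by rw [h01]; exact hu.1)
  have hg : IntervalIntegrable (fun s => s ^ (N - 1) * b s * v s) volume 0 1 :=
    hB.mul_continuousOn (by rw [h01]; exact hv.1)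
  have hh : IntervalIntegrable (fun s => s ^ (N - 1) * (a s - b s) * (u s * v s)) volume 0 1 := by
    simp only [mul_sub]
    exact (hA.sub hB).mul_continuousOn (by rw [h01]; exact hu.1.mul hv.1)
  set P : ℝ → ℝ := fun r => ∫ s in (0:ℝ)..r, s ^ (N - 1) * a s * u s with hPdef
  set Q : ℝ → ℝ := fun r => ∫ s in (0:ℝ)..r, s ^ (N - 1) * b s * v s with hQdef
  set G : ℝ → ℝ := fun r => ∫ s in (0:ℝ)..r, s ^ (N - 1) * (a s - b s) * (u s * v s) with hGdef
  have hPac : AbsolutelyContinuousOnInterval P 0 1 :=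
    hf.absolutelyContinuousOnInterval_intervalIntegral left_mem_uIcc
  have hQac : AbsolutelyContinuousOnInterval Q 0 1 :=
    hg.absolutelyContinuousOnInterval_intervalIntegral left_mem_uIcc
  have hGac : AbsolutelyContinuousOnInterval G 0 1 :=
    hh.absolutelyContinuousOnInterval_intervalIntegral left_mem_uIcc
  set F : ℝ → ℝ := u * Q - P * v + G with hFdef
  have hF0 : F 0 = 0 := by simp [hFdef, hPdef, hQdef, hGdef]
  have hconst : ∀ ε ∈ Ioc (0:ℝ) 1, F ε = F 1 := by
    intro ε hε
    have hsub : uIcc ε 1 ⊆ uIcc (0:ℝ) 1 := by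
      rw [uIcc_of_le hε.2, h01]
      exact Icc_subset_Icc_left hε.1.le
    have hac : AbsolutelyContinuousOnInterval F ε 1 :=
      (((hu.absolutelyContinuous hA hε.1 hε.2).mul (hQac.mono hsub)).sub
        ((hPac.mono hsub).mul (hv.absolutelyContinuous hB hε.1 hε.2))).add (hGac.mono hsub)
    obtain ⟨C, hC⟩ := hac.const_of_ae_hasDerivAt_zero (by
      filter_upwards [hf.ae_hasDerivAt_integral, hg.ae_hasDerivAt_integral,
        hh.ae_hasDerivAt_integral] with x hfx hgx hhx hx
      have hx01 := hsub hx
      have hxI : x ∈ Ioc (0:ℝ) 1 := by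
        rw [uIcc_of_le hε.2] at hx
        exact ⟨hε.1.trans_le hx.1, hx.2⟩
      have hder := (((hu.2.1 x hxI).mul (hgx hx01 0 left_mem_uIcc)).sub
        ((hfx hx01 0 left_mem_uIcc).mul (hv.2.1 x hxI))).add (hhx hx01 0 left_mem_uIcc)
      refine hder.congr_deriv ?_
      have e1 := hu.2.2.1 x hxI
      have e2 := hv.2.2.1 x hxI
      rw [show (∫ s in (0:ℝ)..x, s ^ (N - 1) * a s * u s) = -(x ^ (N - 1) * u' x) by linarith,
        show (∫ s in (0:ℝ)..x, s ^ (N - 1) * b s * v s) = -(x ^ (N - 1) * v' x) by linarith]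
      ring)
    rw [hC ε left_mem_uIcc, hC 1 right_mem_uIcc]
  have hF1 : F 1 = 0 := by
    have hcont : ContinuousOn F (Icc 0 1) := by
      have hPc := hPac.continuousOn
      have hQc := hQac.continuousOn
      have hGc := hGac.continuousOn
      rw [h01] at hPc hQc hGc
      exact ((hu.1.mul hQc).sub (hPc.mul hv.1)).add hGc
    have ht : Tendsto F (nhdsWithin 0 (Ioc 0 1)) (nhds (F 0)) :=
      (hcont 0 (left_mem_Icc.2 zero_le_one)).mono Ioc_subset_Icc_self
    have ht' : Tendsto F (nhdsWithin 0 (Ioc 0 1)) (nhds (F 1)) :=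
      tendsto_const_nhds.congr' (eventually_nhdsWithin_of_forall fun x hx => (hconst x hx).symm)
    have : (nhdsWithin (0:ℝ) (Ioc 0 1)).NeBot := by
      rw [nhdsWithin_Ioc_eq_nhdsGT zero_lt_one]; infer_instance
    rw [← hF0, tendsto_nhds_unique ht' ht]
  rcases hr.1.eq_or_lt with h0 | h0
  · subst h0
    simp [zero_pow (show N - 1 ≠ 0 by omega)]
  · have hFr : F r = 0 := (hconst r ⟨h0, hr.2⟩).trans hF1
    have e1 := hu.2.2.1 r ⟨h0, hr.2⟩
    have e2 := hv.2.2.1 r ⟨h0, hr.2⟩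
    have e3 : u r * Q r - P r * v r + G r = 0 := hFr
    change r ^ (N - 1) * u' r = -P r at e1
    change r ^ (N - 1) * v' r = -Q r at e2
    change _ = -G r
    linear_combination v r * e1 - u r * e2 + e3

theorem IsRadialNeumannSolutionDeriv.neg {N : ℕ} {a u u' : ℝ → ℝ}
    (hu : IsRadialNeumannSolutionDeriv N a u u') : IsRadialNeumannSolutionDeriv N a (-u) (-u') := by
  refine ⟨hu.1.neg, fun r hr => (hu.2.1 r hr).neg, fun r hr => ?_, by simp [hu.2.2.2]⟩
  simp [hu.2.2.1 r hr]

/-- A continuous function without zeros on an open interval has constant sign there. -/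
theorem pos_or_neg_of_ne_zero_on_Ioo {f : ℝ → ℝ} {c d : ℝ} (hf : ContinuousOn f (Ioo c d))
    (h0 : ∀ x ∈ Ioo c d, f x ≠ 0) : (∀ x ∈ Ioo c d, 0 < f x) ∨ ∀ x ∈ Ioo c d, f x < 0 := by
  by_contra! h
  obtain ⟨⟨x, hx, hfx⟩, y, hy, hfy⟩ := h
  obtain ⟨z, hz, hfz⟩ := isPreconnected_Ioo.intermediate_value hx hy hf ⟨hfx, hfy⟩
  exact h0 z hz hfz

theorem HasDerivAt.nonneg_of_zero_of_pos_right {f : ℝ → ℝ} {f' c d : ℝ} (hcd : c < d)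
    (hf : HasDerivAt f f' c) (h0 : f c = 0) (hpos : ∀ x ∈ Ioo c d, 0 < f x) : 0 ≤ f' := by
  have h := (hasDerivAt_iff_tendsto_slope.1 hf).mono_left
    (nhdsWithin_mono c fun x (hx : x ∈ Ioi c) => (ne_of_gt hx : x ≠ c))
  refine ge_of_tendsto h ?_
  filter_upwards [Ioo_mem_nhdsGT hcd] with x hx
  rw [slope_def_field, h0, sub_zero]
  exact div_nonneg (hpos x hx).le (sub_nonneg.2 hx.1.le)

theorem HasDerivAt.nonpos_of_zero_of_pos_left {f : ℝ → ℝ} {f' c d : ℝ} (hcd : c < d)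
    (hf : HasDerivAt f f' d) (h0 : f d = 0) (hpos : ∀ x ∈ Ioo c d, 0 < f x) : f' ≤ 0 := by
  have h := (hasDerivAt_iff_tendsto_slope.1 hf).mono_left
    (nhdsWithin_mono d fun x (hx : x ∈ Iio d) => (ne_of_lt hx : x ≠ d))
  refine le_of_tendsto h ?_
  filter_upwards [Ioo_mem_nhdsLT hcd] with x hx
  rw [slope_def_field, h0, sub_zero]
  exact div_nonpos_of_nonneg_of_nonpos (hpos x hx).le (sub_nonpos.2 hx.2.le)

/-- Sturm comparison for positive solutions between two consecutive nodes. -/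
theorem sturm_comparison_of_pos {N : ℕ} (hN : 2 ≤ N) {a b u u' v v' : ℝ → ℝ}
    (hA : IntervalIntegrable (fun s => s ^ (N - 1) * a s) volume 0 1)
    (hB : IntervalIntegrable (fun s => s ^ (N - 1) * b s) volume 0 1)
    (hab : ∀ᵐ s ∂volume.restrict (Ioo (0:ℝ) 1), b s ≤ a s)
    (hu : IsRadialNeumannSolutionDeriv N a u u') (hv : IsRadialNeumannSolutionDeriv N b v v')
    {c d : ℝ} (hc : 0 ≤ c) (hcd : c < d) (hd : d ≤ 1)
    (hvc : c ≠ 0 → v c = 0 ∧ v' c ≠ 0) (hvd : d ≠ 1 → v d = 0 ∧ v' d ≠ 0)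
    (hupos : ∀ x ∈ Ioo c d, 0 < u x) (hvpos : ∀ x ∈ Ioo c d, 0 < v x) :
    volume (Ioc c d ∩ {s | b s < a s}) = 0 ∧ (c ≠ 0 → u c = 0) ∧ (d ≠ 1 → u d = 0) := by
  have h01 : uIcc (0:ℝ) 1 = Icc 0 1 := uIcc_of_le zero_le_one
  have hcI : c ∈ Icc (0:ℝ) 1 := ⟨hc, hcd.le.trans hd⟩
  have hdI : d ∈ Icc (0:ℝ) 1 := ⟨hc.trans hcd.le, hd⟩
  set h : ℝ → ℝ := fun s => s ^ (N - 1) * (a s - b s) * (u s * v s) with hdef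
  have hh : IntervalIntegrable h volume 0 1 := by
    simp only [hdef, mul_sub]
    exact (hA.sub hB).mul_continuousOn (by rw [h01]; exact hu.1.mul hv.1)
  have hWc := hu.wronskian_eq hN hA hB hv hcI
  have hWd := hu.wronskian_eq hN hA hB hv hdI
  have hucl : ∀ x ∈ Icc c d, 0 ≤ u x := by
    intro x hx
    rw [← closure_Ioo hcd.ne] at hx
    have hcont : ContinuousOn u (closure (Ioo c d)) := by
      rw [closure_Ioo hcd.ne]
      exact hu.1.mono (Icc_subset_Icc hc hd)
    exact closure_minimal (s := u '' Ioo c d) (t := Ici 0)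
      (by rintro _ ⟨y, hy, rfl⟩; exact (hupos y hy).le) isClosed_Ici
      (hcont.image_closure ⟨x, hx, rfl⟩)
  have hleft : c ^ (N - 1) * (u' c * v c - u c * v' c) ≤ 0 ∧
      (c ^ (N - 1) * (u' c * v c - u c * v' c) = 0 → c ≠ 0 → u c = 0) := by
    rcases eq_or_ne c 0 with h0 | h0
    · simp [h0, zero_pow (show N - 1 ≠ 0 by omega)]
    · obtain ⟨hv0, hv'⟩ := hvc h0
      have hc0 : 0 < c := lt_of_le_of_ne hc h0.symm
      have hpow : 0 < c ^ (N - 1) := pow_pos hc0 _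
      have hv'0 := (hv.2.1 c ⟨hc0, hcI.2⟩).nonneg_of_zero_of_pos_right hcd hv0 hvpos
      have huc := hucl c (left_mem_Icc.2 hcd.le)
      rw [hv0, mul_zero, zero_sub]
      refine ⟨mul_nonpos_of_nonneg_of_nonpos hpow.le (neg_nonpos.2 (mul_nonneg huc hv'0)),
        fun he _ => ?_⟩
      simpa [hpow.ne', hv'] using he
  have hright : 0 ≤ d ^ (N - 1) * (u' d * v d - u d * v' d) ∧
      (d ^ (N - 1) * (u' d * v d - u d * v' d) = 0 → d ≠ 1 → u d = 0) := by
    rcases eq_or_ne d 1 with h0 | h0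
    · simp [h0, hu.2.2.2, hv.2.2.2]
    · obtain ⟨hv0, hv'⟩ := hvd h0
      have hd0 : 0 < d := hc.trans_lt hcd
      have hpow : 0 < d ^ (N - 1) := pow_pos hd0 _
      have hv'0 := (hv.2.1 d ⟨hd0, hd⟩).nonpos_of_zero_of_pos_left hcd hv0 hvpos
      have hud := hucl d (right_mem_Icc.2 hcd.le)
      rw [hv0, mul_zero, zero_sub]
      refine ⟨mul_nonneg hpow.le (neg_nonneg.2 (mul_nonpos_of_nonneg_of_nonpos hud hv'0)),
        fun he _ => ?_⟩
      simpa [hpow.ne', hv'] using he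
  have hcdint : IntervalIntegrable h volume c d := hh.mono_set (by
    rw [h01, uIcc_of_le hcd.le]; exact Icc_subset_Icc hc hd)
  have h0c : IntervalIntegrable h volume 0 c := hh.mono_set (by
    rw [h01, uIcc_of_le hc]; exact Icc_subset_Icc_right hcI.2)
  have hadd := intervalIntegral.integral_add_adjacent_intervals h0c hcdint
  have hab' : ∀ᵐ s ∂volume.restrict (Ioo c d), b s ≤ a s :=
    ae_restrict_of_ae_restrict_of_subset (Ioo_subset_Ioo hc hd) hab
  have hnn : ∀ᵐ s ∂volume.restrict (Ioc c d), 0 ≤ h s := by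
    rw [← restrict_Ioo_eq_restrict_Ioc]
    filter_upwards [hab', ae_restrict_mem measurableSet_Ioo] with s hs hsI
    exact mul_nonneg (mul_nonneg (pow_nonneg (hc.trans hsI.1.le) _) (sub_nonneg.2 hs))
      (mul_nonneg (hupos s hsI).le (hvpos s hsI).le)
  have hI : 0 ≤ ∫ s in c..d, h s := intervalIntegral.integral_nonneg_of_ae_restrict hcd.le (by
    rw [← restrict_Ioc_eq_restrict_Icc]; exact hnn)
  have hI0 : ∫ s in c..d, h s = 0 := by linarith [hleft.1, hright.1]
  refine ⟨?_, hleft.2 (by linarith [hleft.1, hright.1]),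
    hright.2 (by linarith [hleft.1, hright.1])⟩
  have hz := (intervalIntegral.integral_eq_zero_iff_of_le_of_nonneg_ae hcd.le hnn hcdint).1 hI0
  have hae : ∀ᵐ s ∂volume.restrict (Ioc c d), ¬ b s < a s := by
    rw [← restrict_Ioo_eq_restrict_Ioc] at hz ⊢
    filter_upwards [hz, ae_restrict_mem measurableSet_Ioo] with s hs hsI hlt
    exact absurd hs (mul_pos (mul_pos (pow_pos (hc.trans_lt hsI.1) _) (sub_pos.2 hlt))
      (mul_pos (hupos s hsI) (hvpos s hsI))).ne'
  rw [ae_restrict_iff' measurableSet_Ioc, ae_iff] at hae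
  convert hae using 2
  ext s
  simp [and_assoc]

/-- Sturm comparison between two consecutive nodes of `v`: either `u` vanishes inside, or the
two potentials agree almost everywhere there and `u` vanishes at the nodes. -/
theorem sturm_comparison {N : ℕ} (hN : 2 ≤ N) {a b u u' v v' : ℝ → ℝ}
    (hA : IntervalIntegrable (fun s => s ^ (N - 1) * a s) volume 0 1)
    (hB : IntervalIntegrable (fun s => s ^ (N - 1) * b s) volume 0 1)
    (hab : ∀ᵐ s ∂volume.restrict (Ioo (0:ℝ) 1), b s ≤ a s)
    (hu : IsRadialNeumannSolutionDeriv N a u u') (hv : IsRadialNeumannSolutionDeriv N b v v')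
    {c d : ℝ} (hc : 0 ≤ c) (hcd : c < d) (hd : d ≤ 1)
    (hvc : c ≠ 0 → v c = 0 ∧ v' c ≠ 0) (hvd : d ≠ 1 → v d = 0 ∧ v' d ≠ 0)
    (hv0 : ∀ x ∈ Ioo c d, v x ≠ 0) :
    (∃ x ∈ Ioo c d, u x = 0) ∨
    (volume (Ioc c d ∩ {s | b s < a s}) = 0 ∧ (c ≠ 0 → u c = 0) ∧ (d ≠ 1 → u d = 0)) := by
  by_cases hu0 : ∃ x ∈ Ioo c d, u x = 0
  · exact Or.inl hu0
  right
  push Not at hu0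
  have hsub : Ioo c d ⊆ Icc 0 1 := Ioo_subset_Icc_self.trans (Icc_subset_Icc hc hd)
  have hvc' : c ≠ 0 → (-v) c = 0 ∧ (-v') c ≠ 0 := by simpa using hvc
  have hvd' : d ≠ 1 → (-v) d = 0 ∧ (-v') d ≠ 0 := by simpa using hvd
  rcases pos_or_neg_of_ne_zero_on_Ioo (hu.1.mono hsub) hu0 with hus | hus <;>
  rcases pos_or_neg_of_ne_zero_on_Ioo (hv.1.mono hsub) hv0 with hvs | hvs
  · exact sturm_comparison_of_pos hN hA hB hab hu hv hc hcd hd hvc hvd hus hvs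
  · exact sturm_comparison_of_pos hN hA hB hab hu hv.neg hc hcd hd hvc' hvd' hus
      fun x hx => neg_pos.2 (hvs x hx)
  · simpa using sturm_comparison_of_pos hN hA hB hab hu.neg hv hc hcd hd hvc hvd
      (fun x hx => neg_pos.2 (hus x hx)) hvs
  · simpa using sturm_comparison_of_pos hN hA hB hab hu.neg hv.neg hc hcd hd hvc' hvd'
      (fun x hx => neg_pos.2 (hus x hx)) fun x hx => neg_pos.2 (hvs x hx)

/-- A measurable radial function in `L^p(B_1)` with `1 ≤ p` is integrable on `B_1`. -/
theorem RadialMemLp.intervalIntegrable {N : ℕ} {p : ℝ} {a : ℝ → ℝ} (hp : 1 ≤ p)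
    (ha : Measurable a) (h : RadialMemLp N p a) :
    IntervalIntegrable (fun s => s ^ (N - 1) * a s) volume 0 1 := by
  rw [intervalIntegrable_iff_integrableOn_Ioo_of_le zero_le_one]
  have hpow : IntegrableOn (fun s : ℝ => s ^ (N - 1)) (Ioo 0 1) :=
    ((continuous_pow (N - 1)).integrableOn_Icc (a := (0:ℝ)) (b := 1)).mono_set Ioo_subset_Icc_self
  refine (hpow.add h).mono' (by fun_prop) ?_
  filter_upwards [ae_restrict_mem measurableSet_Ioo] with s hs
  have hs0 : 0 ≤ s ^ (N - 1) := pow_nonneg hs.1.le _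
  have hle : |a s| ≤ 1 + |a s| ^ p := by
    rcases le_total |a s| 1 with h1 | h1
    · linarith [Real.rpow_nonneg (abs_nonneg (a s)) p]
    · linarith [Real.self_le_rpow_of_one_le h1 hp]
  rw [norm_mul, Real.norm_of_nonneg hs0, Real.norm_eq_abs]
  calc s ^ (N - 1) * |a s| ≤ s ^ (N - 1) * (1 + |a s| ^ p) := by gcongr
    _ = _ := by simp [mul_add]

/-- A measurable bounded radial function is integrable on `B_1`. -/
theorem RadialMemLinfty.intervalIntegrable {N : ℕ} {a : ℝ → ℝ}
    (ha : Measurable a) (h : RadialMemLinfty a) :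
    IntervalIntegrable (fun s => s ^ (N - 1) * a s) volume 0 1 := by
  rw [intervalIntegrable_iff_integrableOn_Ioo_of_le zero_le_one]
  obtain ⟨C, hC⟩ := h
  have hpow : IntegrableOn (fun s : ℝ => s ^ (N - 1) * C) (Ioo 0 1) :=
    (((continuous_pow (N - 1)).mul continuous_const).integrableOn_Icc
      (a := (0:ℝ)) (b := 1)).mono_set Ioo_subset_Icc_self
  refine hpow.mono' (by fun_prop) ?_
  filter_upwards [hC, ae_restrict_mem measurableSet_Ioo] with s hsC hs
  have hs0 : 0 ≤ s ^ (N - 1) := pow_nonneg hs.1.le _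
  rw [norm_mul, Real.norm_of_nonneg hs0, Real.norm_eq_abs]
  gcongr

theorem GammaSet.intervalIntegrable {N : ℕ} {μ : ℝ} {a : ℝ → ℝ} (h : GammaSet N μ a) :
    IntervalIntegrable (fun s => s ^ (N - 1) * a s) volume 0 1 := by
  obtain ⟨hm, -, -, hL⟩ := h
  split_ifs at hL with hN
  · refine hL.intervalIntegrable ?_ hm
    have : (3:ℝ) ≤ N := by exact_mod_cast hN
    linarith
  · rcases hL with ⟨q, hq, hL⟩ | hL
    · exact hL.intervalIntegrable hq.le hm
    · exact hL.intervalIntegrable hm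

/-- If each cell `(c j, c (j + 1))`, `j ≤ k`, of a partition contains a zero of `u` or both of its
interior nodes are zeros, and the former holds in some cell, then `u` has `k + 1` zeros. -/
theorem exists_zeros_of_cells {u : ℝ → ℝ} {k m : ℕ} {c : ℕ → ℝ} (hm : m ≤ k)
    (hc : StrictMonoOn c (Iic (k + 1)))
    (hcell : ∀ j ≤ k, (∃ x ∈ Ioo (c j) (c (j + 1)), u x = 0) ∨
      (j ≠ m ∧ (j ≠ 0 → u (c j) = 0) ∧ (j ≠ k → u (c (j + 1)) = 0))) :
    ∃ Z : Finset ℝ, ↑Z ⊆ Ioo (c 0) (c (k + 1)) ∧ k + 1 ≤ Z.card ∧ ∀ x ∈ Z, u x = 0 := by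
  have hstep : ∀ j ≤ k, c j < c (j + 1) := fun j hj =>
    hc (by simp; omega) (by simp; omega) (Nat.lt_succ_self j)
  have hmono := hc.monotoneOn
  have hz : ∀ j, ∃ x, j ≤ k → u x = 0 ∧ c j ≤ x ∧ x ≤ c (j + 1) ∧
      (j ≤ m → c j < x) ∧ (m ≤ j → x < c (j + 1)) := by
    intro j
    by_cases hj : j ≤ k
    · rcases hcell j hj with ⟨x, hx, hux⟩ | ⟨hjm, h0, h1⟩
      · exact ⟨x, fun _ => ⟨hux, hx.1.le, hx.2.le, fun _ => hx.1, fun _ => hx.2⟩⟩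
      · rcases lt_or_gt_of_ne hjm with hlt | hlt
        · exact ⟨c (j + 1), fun _ => ⟨h1 (by omega), (hstep j hj).le, le_rfl,
            fun _ => hstep j hj, fun _ => by omega⟩⟩
        · exact ⟨c j, fun _ => ⟨h0 (by omega), le_rfl, (hstep j hj).le,
            fun _ => by omega, fun _ => hstep j hj⟩⟩
    · exact ⟨0, fun h => absurd h hj⟩
  choose z hz using hz
  have hlt : ∀ i j, i < j → j ≤ k → z i < z j := by
    intro i j hij hj
    obtain ⟨-, -, hi1, -, hi2⟩ := hz i (by omega)
    obtain ⟨-, hj1, -, hj2, -⟩ := hz j hj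
    have hcij : c (i + 1) ≤ c j := hmono (by simp; omega) (by simp; omega) (by omega)
    rcases le_or_gt m i with h | h
    · exact ((hi2 h).trans_le hcij).trans_le hj1
    · rcases le_or_gt j m with h' | h'
      · exact (hi1.trans hcij).trans_lt (hj2 h')
      · exact (hi1.trans_lt (hc (by simp; omega) (by simp; omega) (by omega))).trans_le hj1
  refine ⟨(Finset.range (k + 1)).image z, ?_, ?_, ?_⟩
  · intro x hx
    simp only [Finset.coe_image, Finset.coe_range, mem_image, mem_Iio] at hx
    obtain ⟨j, hj, rfl⟩ := hx
    obtain ⟨-, hj1, hj2, hj3, hj4⟩ := hz j (by omega)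
    constructor
    · rcases le_or_gt j m with h | h
      · exact (hmono (by simp) (by simp; omega) (Nat.zero_le j)).trans_lt (hj3 h)
      · exact (hc (by simp) (by simp; omega) (by omega)).trans_le hj1
    · rcases le_or_gt m j with h | h
      · exact (hj4 h).trans_le (hmono (by simp; omega) (by simp) (by omega))
      · exact hj2.trans_lt (hc (by simp; omega) (by simp) (by omega))
  · rw [Finset.card_image_of_injOn, Finset.card_range]
    intro i hi j hj hij
    simp only [Finset.coe_range, mem_Iio] at hi hj
    rcases lt_trichotomy i j with h | h | h
    · exact absurd hij (hlt i j h (by omega)).ne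
    · exact h
    · exact absurd hij (hlt j i h (by omega)).ne'
  · intro x hx
    obtain ⟨j, hj, rfl⟩ := Finset.mem_image.1 hx
    exact (hz j (by simpa [Nat.lt_succ_iff] using hj)).1

/-- The half-open cells of a partition cover the interval. -/
theorem exists_mem_Ioc_cell {k : ℕ} {c : ℕ → ℝ} {x : ℝ} (hx : x ∈ Ioc (c 0) (c (k + 1))) :
    ∃ j ≤ k, x ∈ Ioc (c j) (c (j + 1)) := by
  induction k with
  | zero => exact ⟨0, le_rfl, hx⟩
  | succ k ih =>
    rcases le_or_gt x (c (k + 1)) with h | h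
    · obtain ⟨j, hj, hxj⟩ := ih ⟨hx.1, h⟩
      exact ⟨j, by omega, hxj⟩
    · exact ⟨k + 1, le_rfl, h, hx.2⟩

/-- For `k ≥ 0`, `a ∈ Γ_k`, any nontrivial radial Neumann solution `u` of
`Δu + a u = 0` on `B_1` has at least `k + 1` zeros in `(0,1)`. -/
theorem stmt3 (N k : ℕ) (hN : 2 ≤ N) (μk : ℝ) (φk : ℝ → ℝ) (rz : ℕ → ℝ)
    (hek : IsRadialNeumannEigenpair N k μk φk rz)
    (a : ℝ → ℝ) (ha : GammaSet N μk a)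
    (u : ℝ → ℝ) (hu : IsRadialNeumannSolution N a u) (hunt : NontrivialSol u) :
    ∃ Z : Finset ℝ, ↑Z ⊆ Ioo (0:ℝ) 1 ∧ k + 1 ≤ Z.card ∧ ∀ x ∈ Z, u x = 0 := by
  obtain ⟨-, ⟨φ', hφ⟩, -, hrz, hrzlt, hφ0, hsimple⟩ := hek
  obtain ⟨u', hu⟩ := hu
  have hA := ha.intervalIntegrable
  have hB : IntervalIntegrable (fun s => s ^ (N - 1) * (fun _ => μk) s) volume 0 1 :=
    Continuous.intervalIntegrable (by fun_prop) 0 1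
  obtain ⟨hle, hpos⟩ := ha.2.1
  set c : ℕ → ℝ := fun j => if j = 0 then 0 else if j = k + 1 then 1 else rz (k + 1 - j) with hcdef
  have hc0 : c 0 = 0 := by simp [hcdef]
  have hck : c (k + 1) = 1 := by simp [hcdef]
  have hcm : ∀ j, j ≠ 0 → j ≤ k → c j = rz (k + 1 - j) := fun j h0 hj => by
    simp [hcdef, h0, show j ≠ k + 1 by omega]
  have hcI : ∀ j, j ≠ 0 → j ≤ k → c j ∈ Ioo (0:ℝ) 1 := fun j h0 hj => by
    rw [hcm j h0 hj]; exact hrz _ (by omega) (by omega)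
  have hmono : StrictMonoOn c (Iic (k + 1)) := by
    intro i hi j hj hij
    simp only [mem_Iic] at hi hj
    rcases eq_or_ne i 0 with rfl | hi0
    · rw [hc0]
      rcases eq_or_ne j (k + 1) with rfl | hjk
      · rw [hck]; exact zero_lt_one
      · exact (hcI j (by omega) (by omega)).1
    · rcases eq_or_ne j (k + 1) with rfl | hjk
      · rw [hck]; exact (hcI i hi0 (by omega)).2
      · rw [hcm i hi0 (by omega), hcm j (by omega) (by omega)]
        exact hrzlt _ _ (by omega) (by omega) (by omega)
  have hc01 : ∀ j ≤ k + 1, c j ∈ Icc (0:ℝ) 1 := fun j hj => by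
    rw [← hc0, ← hck]
    exact ⟨hmono.monotoneOn (by simp) hj (Nat.zero_le j), hmono.monotoneOn hj (by simp) hj⟩
  have hnode : ∀ j, j ≠ 0 → j ≤ k → φk (c j) = 0 ∧ φ' (c j) ≠ 0 := fun j h0 hj => by
    have hI := hcI j h0 hj
    refine ⟨(hφ0 _ hI).2 ⟨_, by omega, by omega, hcm j h0 hj⟩, ?_⟩
    obtain ⟨d, hd, hder⟩ := hsimple (k + 1 - j) (by omega) (by omega)
    rw [← hcm j h0 hj] at hder
    rwa [(hφ.2.1 _ ⟨hI.1, hI.2.le⟩).unique hder]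
  have hnz : ∀ j ≤ k, ∀ x ∈ Ioo (c j) (c (j + 1)), φk x ≠ 0 := by
    intro j hj x hx h
    obtain ⟨i, hi1, hik, rfl⟩ := (hφ0 x
      ⟨(hc01 j (by omega)).1.trans_lt hx.1, hx.2.trans_le (hc01 (j + 1) (by omega)).2⟩).1 h
    have hi : c (k + 1 - i) = rz i := by
      rw [hcm _ (by omega) (by omega)]; congr 1; omega
    rw [← hi] at hx
    have h1 := (hmono.lt_iff_lt (by simp; omega) (by simp)).1 hx.1
    have h2 := (hmono.lt_iff_lt (by simp) (by simp; omega)).1 hx.2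
    omega
  have hcell : ∀ j ≤ k, (∃ x ∈ Ioo (c j) (c (j + 1)), u x = 0) ∨
      (volume (Ioc (c j) (c (j + 1)) ∩ {s | μk < a s}) = 0 ∧
        (c j ≠ 0 → u (c j) = 0) ∧ (c (j + 1) ≠ 1 → u (c (j + 1)) = 0)) := by
    intro j hj
    refine sturm_comparison hN hA hB hle hu hφ (hc01 j (by omega)).1
      (hmono (by simp; omega) (by simp; omega) (Nat.lt_succ_self j)) (hc01 (j + 1) (by omega)).2
      (fun h => hnode j ?_ hj) (fun h => hnode (j + 1) (by omega) ?_) (hnz j hj)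
    · rintro rfl; exact h hc0
    · by_contra hjk
      exact h (by rw [show j = k by omega, hck])
  obtain ⟨m, hm, hmpos⟩ : ∃ m ≤ k, volume (Ioc (c m) (c (m + 1)) ∩ {s | μk < a s}) ≠ 0 := by
    by_contra! hnull
    refine hpos.ne' (measure_mono_null (t := ⋃ j ∈ Iic k, Ioc (c j) (c (j + 1)) ∩ {s | μk < a s})
      ?_ ((measure_biUnion_null_iff (finite_Iic k).countable).2 hnull))
    rintro x ⟨hx, hxa⟩
    obtain ⟨j, hj, hxj⟩ := exists_mem_Ioc_cell (k := k) (c := c) (x := x)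
      (by rw [hc0, hck]; exact ⟨hx.1, hx.2.le⟩)
    exact mem_biUnion hj ⟨hxj, hxa⟩
  have hzeros := exists_zeros_of_cells (u := u) hm hmono fun j hj =>
    (hcell j hj).imp_right fun ⟨h, h0, h1⟩ =>
      ⟨fun he => hmpos (he ▸ h), fun hj0 => h0 (hcI j hj0 hj).1.ne',
        fun hjk => h1 (hcI (j + 1) (by omega) (by omega)).2.ne⟩
  rwa [hc0, hck] at hzeros
end
end
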